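/- arXiv:1603.01379 — 5 statements merged into one kernel-verified Lean document; each statement's English description precedes it below -/
import Mathlib

section
/- Let n ≥ 1, let ν ∈ S^{2n} be a unit vector in ℝ^{2n+1} and d ∈ ℝ, and let Π⁺_{ν,d} = {ξ ∈ ℝ^{2n+1} : ⟨ξ, ν⟩ > d}. Then for every u ∈ C_0^∞(Π⁺_{ν,d}) one has ∫_{Π⁺_{ν,d}} |∇_{ℍⁿ} u|² dξ ≥ (1/4) ∫_{Π⁺_{ν,d}} Σ_{i=1}^n (⟨X_i(ξ), ν⟩² + ⟨Y_i(ξ), ν⟩²) / dist(ξ, ∂Π⁺_{ν,d})² · |u|² dξ, where dist(ξ, ∂Π⁺_{ν,d}) = ⟨ξ, ν⟩ − d is the Euclidean distance to the boundary hyperplane. -/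
open MeasureTheory RealInnerProductSpace

noncomputable section

/-- The Heisenberg group `ℍⁿ`, identified with Euclidean `ℝ^{2n+1}`;
coordinates `0,…,n-1` are `x`, `n,…,2n-1` are `y`, and `2n` is `t`. -/
abbrev Heis (n : ℕ) := EuclideanSpace ℝ (Fin (2 * n + 1))

/-- Index of the coordinate `x_i`. -/
def xIdx {n : ℕ} (i : Fin n) : Fin (2 * n + 1) := ⟨i.1, by have := i.2; omega⟩

/-- Index of the coordinate `y_i`. -/
def yIdx {n : ℕ} (i : Fin n) : Fin (2 * n + 1) := ⟨n + i.1, by have := i.2; omega⟩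

/-- Index of the coordinate `t`. -/
def tIdx (n : ℕ) : Fin (2 * n + 1) := ⟨2 * n, by omega⟩

/-- The horizontal vector field `X_i = ∂/∂x_i + 2 y_i ∂/∂t` acting on a function. -/
def Xd {n : ℕ} (i : Fin n) (u : Heis n → ℝ) (ξ : Heis n) : ℝ :=
  fderiv ℝ u ξ (EuclideanSpace.single (xIdx i) 1)
    + 2 * ξ (yIdx i) * fderiv ℝ u ξ (EuclideanSpace.single (tIdx n) 1)

/-- The horizontal vector field `Y_i = ∂/∂y_i − 2 x_i ∂/∂t` acting on a function. -/
def Yd {n : ℕ} (i : Fin n) (u : Heis n → ℝ) (ξ : Heis n) : ℝ :=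
  fderiv ℝ u ξ (EuclideanSpace.single (yIdx i) 1)
    - 2 * ξ (xIdx i) * fderiv ℝ u ξ (EuclideanSpace.single (tIdx n) 1)

/-- `|∇_{ℍⁿ} u|² = Σ_i (X_i u)² + (Y_i u)²`. -/
def gradH2 {n : ℕ} (u : Heis n → ℝ) (ξ : Heis n) : ℝ :=
  ∑ i : Fin n, ((Xd i u ξ) ^ 2 + (Yd i u ξ) ^ 2)

/-- `⟨X_i(ξ), ν⟩ = ν_{x_i} + 2 y_i ν_t`. -/
def XiNu {n : ℕ} (i : Fin n) (ξ ν : Heis n) : ℝ := ν (xIdx i) + 2 * ξ (yIdx i) * ν (tIdx n)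

/-- `⟨Y_i(ξ), ν⟩ = ν_{y_i} − 2 x_i ν_t`. -/
def YiNu {n : ℕ} (i : Fin n) (ξ ν : Heis n) : ℝ := ν (yIdx i) - 2 * ξ (xIdx i) * ν (tIdx n)

/-- The boundary term vanishes: `∫ (∂_p w + c ∂_q w) = 0` for compactly supported `w` when the
linear functional `c` vanishes on `q`. -/
lemma integral_fderiv_add_mul_fderiv_eq_zero {E : Type*} [NormedAddCommGroup E]
    [NormedSpace ℝ E] [FiniteDimensional ℝ E] [MeasurableSpace E] [BorelSpace E]
    (μ : Measure E) [μ.IsAddHaarMeasure] (c : E →L[ℝ] ℝ) (p q : E) (hcq : c q = 0)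
    {w : E → ℝ} (hw : ContDiff ℝ 1 w) (hc : HasCompactSupport w) :
    Integrable (fun ξ => fderiv ℝ w ξ p + c ξ * fderiv ℝ w ξ q) μ ∧
      ∫ ξ, (fderiv ℝ w ξ p + c ξ * fderiv ℝ w ξ q) ∂μ = 0 := by
  have hcont (v : E) : Continuous (fun ξ => fderiv ℝ w ξ v) :=
    (hw.continuous_fderiv one_ne_zero).clm_apply continuous_const
  have hint (f : E → ℝ) (hf : Continuous f) (v : E) :
      Integrable (fun ξ => f ξ * fderiv ℝ w ξ v) μ :=
    (hf.mul (hcont v)).integrable_of_hasCompactSupport (hc.fderiv_apply (𝕜 := ℝ) v).mul_left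
  have hwint (f : E → ℝ) (hf : Continuous f) : Integrable (fun ξ => f ξ * w ξ) μ :=
    (hf.mul hw.continuous).integrable_of_hasCompactSupport hc.mul_left
  have hdiff : Differentiable ℝ w := hw.differentiable one_ne_zero
  have h1 : ∫ ξ, fderiv ℝ w ξ p ∂μ = 0 := by
    have h := integral_mul_fderiv_eq_neg_fderiv_mul_of_integrable (μ := μ)
      (f := fun _ : E => (1 : ℝ)) (g := w) (v := p) (by simp) (hint _ continuous_const p)
      (hwint _ continuous_const) (fun _ _ => differentiableAt_const _) (fun _ _ => hdiff _)
    simpa using h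
  have h2 : ∫ ξ, c ξ * fderiv ℝ w ξ q ∂μ = 0 := by
    have h := integral_mul_fderiv_eq_neg_fderiv_mul_of_integrable (μ := μ)
      (f := fun ξ => c ξ) (g := w) (v := q) (by simp [hcq]) (hint _ c.continuous q)
      (hwint _ c.continuous) (fun _ _ => c.differentiableAt) (fun _ _ => hdiff _)
    simpa [hcq] using h
  have hp : Integrable (fun ξ => fderiv ℝ w ξ p) μ := by
    simpa using hint _ (continuous_const (y := (1 : ℝ))) p
  exact ⟨hp.add (hint _ c.continuous q), by
    rw [integral_add hp (hint _ c.continuous q), h1, h2, add_zero]⟩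

/-- A function that is smooth at every point of its topological support is smooth. -/
lemma contDiff_of_contDiffAt_tsupport {E : Type*} [NormedAddCommGroup E] [NormedSpace ℝ E]
    {k : WithTop ℕ∞} {f : E → ℝ} (hf : ∀ x ∈ tsupport f, ContDiffAt ℝ k f x) :
    ContDiff ℝ k f :=
  contDiff_iff_contDiffAt.2 fun x => by
    by_cases hx : x ∈ tsupport f
    · exact hf x hx
    · exact (contDiffAt_const (c := (0 : ℝ))).congr_of_eventuallyEq
        (notMem_tsupport_iff_eventuallyEq.1 hx)

/-- Hardy inequality on a half-space along a single vector field `p + c(ξ) q` whose linear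
coefficient `c` vanishes on `p` and `q`. -/
lemma hardy_halfspace_vectorField {E : Type*} [NormedAddCommGroup E]
    [NormedSpace ℝ E] [FiniteDimensional ℝ E] [MeasurableSpace E] [BorelSpace E]
    (μ : Measure E) [μ.IsAddHaarMeasure] (l c : E →L[ℝ] ℝ) (d : ℝ) (p q : E)
    (hcp : c p = 0) (hcq : c q = 0) {u : E → ℝ} (hu : ContDiff ℝ 1 u)
    (hc : HasCompactSupport u) (hsupp : tsupport u ⊆ {ξ | d < l ξ}) :
    Integrable (fun ξ => (fderiv ℝ u ξ p + c ξ * fderiv ℝ u ξ q) ^ 2) μ ∧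
    Integrable (fun ξ => (l p + c ξ * l q) ^ 2 / (l ξ - d) ^ 2 * u ξ ^ 2) μ ∧
    (1 / 4) * ∫ ξ, (l p + c ξ * l q) ^ 2 / (l ξ - d) ^ 2 * u ξ ^ 2 ∂μ ≤
      ∫ ξ, (fderiv ℝ u ξ p + c ξ * fderiv ℝ u ξ q) ^ 2 ∂μ := by
  have hpos {ξ : E} (hξ : ξ ∈ tsupport u) : l ξ - d ≠ 0 := (sub_pos.2 (hsupp hξ)).ne'
  have hcont (v : E) : Continuous (fun ξ => fderiv ℝ u ξ v) :=
    (hu.continuous_fderiv one_ne_zero).clm_apply continuous_const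
  have hmono {f : E → ℝ} (hf : ∀ ξ, u ξ = 0 → f ξ = 0) : tsupport f ⊆ tsupport u :=
    closure_mono fun ξ hξ h => hξ (hf ξ h)
  set w : E → ℝ := fun ξ => (l p + c ξ * l q) * (u ξ ^ 2 / (l ξ - d)) with hw_def
  have hw_supp : tsupport w ⊆ tsupport u := hmono fun ξ h => by simp [hw_def, h]
  have hw : ContDiff ℝ 1 w := contDiff_of_contDiffAt_tsupport fun ξ hξ => by
    refine ContDiffAt.mul (by fun_prop) (ContDiffAt.div ?_ (by fun_prop) (hpos (hw_supp hξ)))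
    exact hu.contDiffAt.pow 2
  have hwc : HasCompactSupport w := hc.of_isClosed_subset (isClosed_tsupport _) hw_supp
  obtain ⟨hLw, hLw0⟩ := integral_fderiv_add_mul_fderiv_eq_zero μ c p q hcq hw hwc
  have hA : Integrable (fun ξ => (fderiv ℝ u ξ p + c ξ * fderiv ℝ u ξ q) ^ 2) μ := by
    refine Continuous.integrable_of_hasCompactSupport
      (((hcont p).add (c.continuous.mul (hcont q))).pow 2) ?_
    refine hc.mono' fun ξ hξ => ?_
    by_contra h
    have h0 : fderiv ℝ u ξ = 0 := by
      by_contra h1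
      exact h (support_fderiv_subset ℝ h1)
    simp [h0] at hξ
  have hB : Integrable (fun ξ => (l p + c ξ * l q) ^ 2 / (l ξ - d) ^ 2 * u ξ ^ 2) μ := by
    have hs : tsupport (fun ξ => (l p + c ξ * l q) ^ 2 / (l ξ - d) ^ 2 * u ξ ^ 2) ⊆ tsupport u :=
      hmono fun ξ h => by simp [h]
    refine Continuous.integrable_of_hasCompactSupport ?_
      (hc.of_isClosed_subset (isClosed_tsupport _) hs)
    refine (contDiff_of_contDiffAt_tsupport (k := 1) fun ξ hξ => ?_).continuous
    exact ContDiffAt.mul (ContDiffAt.div (by fun_prop) (by fun_prop)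
      (pow_ne_zero 2 (hpos (hs hξ)))) (hu.contDiffAt.pow 2)
  refine ⟨hA, hB, ?_⟩
  have hpt (ξ : E) : (1 / 4) * ((l p + c ξ * l q) ^ 2 / (l ξ - d) ^ 2 * u ξ ^ 2) +
      (1 / 2) * (fderiv ℝ w ξ p + c ξ * fderiv ℝ w ξ q) ≤
        (fderiv ℝ u ξ p + c ξ * fderiv ℝ u ξ q) ^ 2 := by
    by_cases hξ : ξ ∈ tsupport u
    · have hδ := hpos hξ
      have hdu : HasFDerivAt u (fderiv ℝ u ξ) ξ :=
        (hu.differentiable one_ne_zero).differentiableAt.hasFDerivAt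
      have hdw := ((c.hasFDerivAt (x := ξ)).mul_const (l q)).const_add (l p) |>.mul
        ((hdu.pow 2).mul (((hasDerivAt_inv hδ).comp_hasFDerivAt ξ
          ((l.hasFDerivAt (x := ξ)).sub_const d))))
      have hfd (v : E) (hv : c v = 0) : fderiv ℝ w ξ v = (l p + c ξ * l q) *
          (2 * u ξ * fderiv ℝ u ξ v / (l ξ - d) - u ξ ^ 2 * l v / (l ξ - d) ^ 2) := by
        have he : fderiv ℝ w ξ = _ := HasFDerivAt.fderiv hdw
        rw [he]
        simp [hv]
        ring
      rw [hfd p hcp, hfd q hcq]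
      have hsq := sq_nonneg ((fderiv ℝ u ξ p + c ξ * fderiv ℝ u ξ q) -
        (l p + c ξ * l q) * u ξ / (2 * (l ξ - d)))
      refine sub_nonneg.1 (hsq.trans_eq ?_)
      field_simp
      ring
    · have h0 : u ξ = 0 := image_eq_zero_of_notMem_tsupport hξ
      have h1 : fderiv ℝ w ξ = 0 := by
        by_contra h1
        exact hξ (hw_supp (support_fderiv_subset ℝ h1))
      simp only [h0, h1]
      simp
      positivity
  calc (1 / 4) * ∫ ξ, (l p + c ξ * l q) ^ 2 / (l ξ - d) ^ 2 * u ξ ^ 2 ∂μ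
      = ∫ ξ, ((1 / 4) * ((l p + c ξ * l q) ^ 2 / (l ξ - d) ^ 2 * u ξ ^ 2) +
          (1 / 2) * (fderiv ℝ w ξ p + c ξ * fderiv ℝ w ξ q)) ∂μ := by
        rw [integral_add (hB.const_mul _) (hLw.const_mul _), integral_const_mul,
          integral_const_mul, hLw0, mul_zero, add_zero]
    _ ≤ _ := integral_mono ((hB.const_mul _).add (hLw.const_mul _)) hA hpt

/-- The single-field Hardy inequality along `X_i`. -/
lemma hardy_halfspace_X {n : ℕ} (i : Fin n) (ν : Heis n) (d : ℝ)
    {u : Heis n → ℝ} (hu : ContDiff ℝ 1 u) (hc : HasCompactSupport u)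
    (hsupp : tsupport u ⊆ {ξ : Heis n | d < ⟪ξ, ν⟫}) :
    Integrable (fun ξ => Xd i u ξ ^ 2) ∧
    Integrable (fun ξ => XiNu i ξ ν ^ 2 / (⟪ξ, ν⟫ - d) ^ 2 * u ξ ^ 2) ∧
    (1 / 4) * ∫ ξ, XiNu i ξ ν ^ 2 / (⟪ξ, ν⟫ - d) ^ 2 * u ξ ^ 2 ≤ ∫ ξ, Xd i u ξ ^ 2 := by
  have hi := i.2
  have hyx : yIdx i ≠ xIdx i := by simp [xIdx, yIdx]; omega
  have hyt : yIdx i ≠ tIdx n := by simp [tIdx, yIdx]; omega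
  have h := hardy_halfspace_vectorField volume (innerSL ℝ ν)
    ((2 : ℝ) • EuclideanSpace.proj (yIdx i) : Heis n →L[ℝ] ℝ) d
    (EuclideanSpace.single (xIdx i) 1) (EuclideanSpace.single (tIdx n) 1)
    (by simp [hyx]) (by simp [hyt]) hu hc
    (by simpa only [innerSL_apply_apply, real_inner_comm] using hsupp)
  simpa [Xd, XiNu, real_inner_comm, EuclideanSpace.inner_single_right] using h

/-- The single-field Hardy inequality along `Y_i`. -/
lemma hardy_halfspace_Y {n : ℕ} (i : Fin n) (ν : Heis n) (d : ℝ)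
    {u : Heis n → ℝ} (hu : ContDiff ℝ 1 u) (hc : HasCompactSupport u)
    (hsupp : tsupport u ⊆ {ξ : Heis n | d < ⟪ξ, ν⟫}) :
    Integrable (fun ξ => Yd i u ξ ^ 2) ∧
    Integrable (fun ξ => YiNu i ξ ν ^ 2 / (⟪ξ, ν⟫ - d) ^ 2 * u ξ ^ 2) ∧
    (1 / 4) * ∫ ξ, YiNu i ξ ν ^ 2 / (⟪ξ, ν⟫ - d) ^ 2 * u ξ ^ 2 ≤ ∫ ξ, Yd i u ξ ^ 2 := by
  have hi := i.2
  have hxy : xIdx i ≠ yIdx i := by simp [xIdx, yIdx]; omega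
  have hxt : xIdx i ≠ tIdx n := by simp [tIdx, xIdx]; omega
  have h := hardy_halfspace_vectorField volume (innerSL ℝ ν)
    ((-2 : ℝ) • EuclideanSpace.proj (xIdx i) : Heis n →L[ℝ] ℝ) d
    (EuclideanSpace.single (yIdx i) 1) (EuclideanSpace.single (tIdx n) 1)
    (by simp [hxy]) (by simp [hxt]) hu hc
    (by simpa only [innerSL_apply_apply, real_inner_comm] using hsupp)
  simpa [Yd, YiNu, real_inner_comm, EuclideanSpace.inner_single_right, sub_eq_add_neg] using h

/-- Theorem 1 of the paper: the geometric `L²` Hardy inequality on the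
half-space `Π⁺_{ν,d} = {ξ : ⟨ξ, ν⟩ > d}` of the Heisenberg group, where
`dist(ξ, ∂Π⁺_{ν,d}) = ⟨ξ, ν⟩ − d`. -/
theorem hardy_halfspace_L2 (n : ℕ) (hn : 1 ≤ n) (ν : Heis n) (hν : ‖ν‖ = 1) (d : ℝ)
    (u : Heis n → ℝ) (hu : ContDiff ℝ (⊤ : ℕ∞) u) (hc : HasCompactSupport u)
    (hsupp : tsupport u ⊆ {ξ : Heis n | d < ⟪ξ, ν⟫}) :
    ∫ ξ in {ξ : Heis n | d < ⟪ξ, ν⟫}, gradH2 u ξ ≥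
      (1 / 4) * ∫ ξ in {ξ : Heis n | d < ⟪ξ, ν⟫},
        (∑ i : Fin n, ((XiNu i ξ ν) ^ 2 + (YiNu i ξ ν) ^ 2)) / (⟪ξ, ν⟫ - d) ^ 2
          * (u ξ) ^ 2 := by
  have hu1 : ContDiff ℝ 1 u := hu.of_le (by exact_mod_cast le_top)
  have hX := fun i : Fin n => hardy_halfspace_X i ν d hu1 hc hsupp
  have hY := fun i : Fin n => hardy_halfspace_Y i ν d hu1 hc hsupp
  rw [setIntegral_eq_integral_of_forall_compl_eq_zero,
    setIntegral_eq_integral_of_forall_compl_eq_zero]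
  · have hR : (fun ξ : Heis n => (∑ i : Fin n, ((XiNu i ξ ν) ^ 2 + (YiNu i ξ ν) ^ 2)) /
        (⟪ξ, ν⟫ - d) ^ 2 * (u ξ) ^ 2) = fun ξ => ∑ i : Fin n,
          (XiNu i ξ ν ^ 2 / (⟪ξ, ν⟫ - d) ^ 2 * u ξ ^ 2 +
            YiNu i ξ ν ^ 2 / (⟪ξ, ν⟫ - d) ^ 2 * u ξ ^ 2) := by
      funext ξ
      rw [Finset.sum_div, Finset.sum_mul]
      exact Finset.sum_congr rfl fun i _ => by ring
    rw [hR]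
    simp only [gradH2]
    rw [integral_finsetSum _ fun i _ => by exact (hX i).1.add (hY i).1,
      integral_finsetSum _ fun i _ => by exact (hX i).2.1.add (hY i).2.1, Finset.mul_sum]
    refine Finset.sum_le_sum fun i _ => ?_
    rw [integral_add (hX i).1 (hY i).1, integral_add (hX i).2.1 (hY i).2.1, mul_add]
    exact add_le_add (hX i).2.2 (hY i).2.2
  · intro ξ hξ
    simp [image_eq_zero_of_notMem_tsupport fun h => hξ (hsupp h)]
  · intro ξ hξ
    have h0 : fderiv ℝ u ξ = 0 := by
      by_contra h1
      exact hξ (hsupp (support_fderiv_subset ℝ h1))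
    simp [gradH2, Xd, Yd, h0]
end
end

section
/- Let n ≥ 1 and let ℍⁿ₊ = {(x, y, t) ∈ ℝⁿ × ℝⁿ × ℝ : t > 0}. Then for every u ∈ C_0^∞(ℍⁿ₊) one has ∫_{ℍⁿ₊} |∇_{ℍⁿ} u|² dξ ≥ ∫_{ℍⁿ₊} ((|x|² + |y|²)/t²) |u|² dξ. -/
open MeasureTheory RealInnerProductSpace

noncomputable section

/-- Integration by parts against a smooth function that is constant in the direction `v`. -/
lemma integral_mul_fderiv_eq_zero {E : Type*} [NormedAddCommGroup E] [NormedSpace ℝ E]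
    [FiniteDimensional ℝ E] [MeasurableSpace E] [BorelSpace E] (μ : Measure E)
    [μ.IsAddHaarMeasure] {f g : E → ℝ} (v : E) (hf : ContDiff ℝ 1 f) (hg : ContDiff ℝ 1 g)
    (hc : HasCompactSupport g) (hv : ∀ x, fderiv ℝ f x v = 0) :
    Integrable (fun x => f x * fderiv ℝ g x v) μ ∧ ∫ x, f x * fderiv ℝ g x v ∂μ = 0 := by
  have hg' : Continuous fun x => fderiv ℝ g x v :=
    (hg.continuous_fderiv one_ne_zero).clm_apply continuous_const
  have hint : Integrable (fun x => f x * fderiv ℝ g x v) μ :=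
    (hf.continuous.mul hg').integrable_of_hasCompactSupport (hc.fderiv_apply ℝ v).mul_left
  refine ⟨hint, ?_⟩
  rw [integral_mul_fderiv_eq_neg_fderiv_mul_of_integrable _ hint
    ((hf.continuous.mul hg.continuous).integrable_of_hasCompactSupport hc.mul_left)
    (fun x _ => hf.differentiable one_ne_zero x)
    (fun x _ => hg.differentiable one_ne_zero x)]
  · simp [hv]
  · simp [hv]

/-- Dividing a smooth function by a smooth function that does not vanish on its support. -/
lemma contDiff_div_of_ne_zero_on_tsupport {E : Type*} [NormedAddCommGroup E] [NormedSpace ℝ E]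
    {k : WithTop ℕ∞} {u τ : E → ℝ} (hu : ContDiff ℝ k u) (hτ : ContDiff ℝ k τ)
    (h : ∀ x ∈ tsupport u, τ x ≠ 0) : ContDiff ℝ k fun x => u x / τ x := by
  rw [contDiff_iff_contDiffAt]
  intro x
  by_cases hx : x ∈ tsupport u
  · exact hu.contDiffAt.div hτ.contDiffAt (h x hx)
  · refine (contDiffAt_const (c := (0 : ℝ))).congr_of_eventuallyEq ?_
    filter_upwards [notMem_tsupport_iff_eventuallyEq.mp hx] with y hy
    simp [hy]

lemma fderiv_coord {ι : Type*} [Fintype ι] (i : ι) (x v : EuclideanSpace ℝ ι) :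
    fderiv ℝ (fun y : EuclideanSpace ℝ ι => y i) x v = v i := by
  have h : HasFDerivAt (fun y : EuclideanSpace ℝ ι => y i)
      (EuclideanSpace.proj i : EuclideanSpace ℝ ι →L[ℝ] ℝ) x :=
    (EuclideanSpace.proj i : EuclideanSpace ℝ ι →L[ℝ] ℝ).hasFDerivAt
  rw [h.fderiv]
  rfl

lemma contDiff_coord {ι : Type*} [Fintype ι] {k : WithTop ℕ∞} (i : ι) :
    ContDiff ℝ k fun y : EuclideanSpace ℝ ι => y i :=
  (EuclideanSpace.proj i : EuclideanSpace ℝ ι →L[ℝ] ℝ).contDiff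

lemma fderiv_coord_sq_add_sq {ι : Type*} [Fintype ι] (i j : ι) (x v : EuclideanSpace ℝ ι)
    (hi : v i = 0) (hj : v j = 0) :
    fderiv ℝ (fun y : EuclideanSpace ℝ ι => y i ^ 2 + y j ^ 2) x v = 0 := by
  have hd (k : ι) : DifferentiableAt ℝ (fun y : EuclideanSpace ℝ ι => y k) x :=
    (contDiff_coord (k := 1) k).differentiable one_ne_zero x
  rw [fderiv_fun_add ((hd i).fun_pow 2) ((hd j).fun_pow 2), fderiv_fun_pow 2 (hd i),
    fderiv_fun_pow 2 (hd j)]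
  simp [fderiv_coord, hi, hj]

lemma xIdx_ne_tIdx {n : ℕ} (i : Fin n) : xIdx i ≠ tIdx n := by
  have := i.2; simp only [xIdx, tIdx, ne_eq, Fin.mk.injEq]; omega

lemma yIdx_ne_tIdx {n : ℕ} (i : Fin n) : yIdx i ≠ tIdx n := by
  have := i.2; simp only [yIdx, tIdx, ne_eq, Fin.mk.injEq]; omega

lemma xIdx_ne_yIdx {n : ℕ} (i : Fin n) : xIdx i ≠ yIdx i := by
  have := i.2; simp only [xIdx, yIdx, ne_eq, Fin.mk.injEq]; omega

/-- The divergence term produced by completing the square in the Hardy inequality. -/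
def hardyDiv {n : ℕ} (g : Heis n → ℝ) (i : Fin n) (ξ : Heis n) : ℝ :=
  ξ (yIdx i) * fderiv ℝ g ξ (EuclideanSpace.single (xIdx i) 1)
    - ξ (xIdx i) * fderiv ℝ g ξ (EuclideanSpace.single (yIdx i) 1)
    + 2 * ((ξ (xIdx i) ^ 2 + ξ (yIdx i) ^ 2)
      * fderiv ℝ g ξ (EuclideanSpace.single (tIdx n) 1))

lemma integral_hardyDiv {n : ℕ} {g : Heis n → ℝ} (hg : ContDiff ℝ 1 g)
    (hc : HasCompactSupport g) (i : Fin n) :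
    Integrable (hardyDiv g i) ∧ ∫ ξ, hardyDiv g i ξ = 0 := by
  obtain ⟨hX, hX0⟩ := integral_mul_fderiv_eq_zero volume
    (EuclideanSpace.single (xIdx i) 1) (contDiff_coord (yIdx i)) hg hc
    (fun ξ => by simp [fderiv_coord, (xIdx_ne_yIdx i).symm])
  obtain ⟨hY, hY0⟩ := integral_mul_fderiv_eq_zero volume
    (EuclideanSpace.single (yIdx i) 1) (contDiff_coord (xIdx i)) hg hc
    (fun ξ => by simp [fderiv_coord, xIdx_ne_yIdx i])
  obtain ⟨hT, hT0⟩ := integral_mul_fderiv_eq_zero volume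
    (EuclideanSpace.single (tIdx n) 1)
    (((contDiff_coord (xIdx i)).pow 2).add ((contDiff_coord (yIdx i)).pow 2)) hg hc
    (fun ξ => fderiv_coord_sq_add_sq _ _ _ _ (by simp [xIdx_ne_tIdx i])
      (by simp [yIdx_ne_tIdx i]))
  refine ⟨(hX.sub hY).add (hT.const_mul 2), ?_⟩
  unfold hardyDiv
  rw [integral_add (by exact hX.sub hY) (hT.const_mul 2), integral_sub hX hY, integral_const_mul,
    hX0, hY0, hT0]
  simp

/-- The pointwise inequality behind the Hardy inequality, for `u = t q`. -/
lemma hardyDiv_le {n : ℕ} {u q : Heis n → ℝ} (hq : Differentiable ℝ q)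
    (huq : u = fun ξ => ξ (tIdx n) * q ξ) (ξ : Heis n) :
    (∑ i : Fin n, (ξ (xIdx i) ^ 2 + ξ (yIdx i) ^ 2)) * q ξ ^ 2
      + ∑ i, hardyDiv (fun ξ => u ξ * q ξ) i ξ ≤ gradH2 u ξ := by
  have ht : DifferentiableAt ℝ (fun y : Heis n => y (tIdx n)) ξ :=
    (contDiff_coord (k := 1) _).differentiable one_ne_zero ξ
  have hu : DifferentiableAt ℝ u ξ := huq ▸ ht.mul (hq ξ)
  have hDu (v : Heis n) : fderiv ℝ u ξ v = ξ (tIdx n) * fderiv ℝ q ξ v + q ξ * v (tIdx n) := by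
    rw [huq, fderiv_fun_mul ht (hq ξ)]
    simp [fderiv_coord]
  have hDg (v : Heis n) : fderiv ℝ (fun ξ => u ξ * q ξ) ξ v
      = u ξ * fderiv ℝ q ξ v + q ξ * fderiv ℝ u ξ v := by
    rw [fderiv_fun_mul hu (hq ξ)]
    simp
  have hu0 : u ξ = ξ (tIdx n) * q ξ := congrFun huq ξ
  rw [Finset.sum_mul, ← Finset.sum_add_distrib, gradH2]
  refine Finset.sum_le_sum fun i _ => ?_
  simp only [hardyDiv, Xd, Yd, hDg, hDu, hu0, PiLp.single_apply,
    (xIdx_ne_tIdx i).symm, (yIdx_ne_tIdx i).symm, if_true, if_false]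
  set a := fderiv ℝ q ξ (EuclideanSpace.single (xIdx i) 1)
  set b := fderiv ℝ q ξ (EuclideanSpace.single (yIdx i) 1)
  set c := fderiv ℝ q ξ (EuclideanSpace.single (tIdx n) 1)
  set t := ξ (tIdx n)
  set x := ξ (xIdx i)
  set y := ξ (yIdx i)
  linarith [sq_nonneg (t * a + 2 * y * (t * c + q ξ) - y * q ξ),
    sq_nonneg (t * b - 2 * x * (t * c + q ξ) + x * q ξ)]

lemma continuous_gradH2 {n : ℕ} {u : Heis n → ℝ} (hu : ContDiff ℝ 1 u) :
    Continuous (gradH2 u) := by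
  have hD (v : Heis n) : Continuous fun ξ => fderiv ℝ u ξ v :=
    (hu.continuous_fderiv one_ne_zero).clm_apply continuous_const
  unfold gradH2 Xd Yd
  fun_prop

lemma gradH2_eq_zero_of_notMem_tsupport {n : ℕ} {u : Heis n → ℝ} {ξ : Heis n}
    (hξ : ξ ∉ tsupport u) : gradH2 u ξ = 0 := by
  have h : fderiv ℝ u ξ = 0 := by
    by_contra h
    exact hξ (support_fderiv_subset ℝ h)
  simp [gradH2, Xd, Yd, h]

/-- inequality of Luan–Yang: the Hardy inequality on the upper half-space
`ℍⁿ₊ = {(x,y,t) : t > 0}` with weight `(|x|² + |y|²)/t²`. -/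
theorem hardy_upper_halfspace (n : ℕ) (hn : 1 ≤ n)
    (u : Heis n → ℝ) (hu : ContDiff ℝ (⊤ : ℕ∞) u) (hc : HasCompactSupport u)
    (hsupp : tsupport u ⊆ {ξ : Heis n | 0 < ξ (tIdx n)}) :
    ∫ ξ in {ξ : Heis n | 0 < ξ (tIdx n)}, gradH2 u ξ ≥
      ∫ ξ in {ξ : Heis n | 0 < ξ (tIdx n)},
        ((∑ i : Fin n, ((ξ (xIdx i)) ^ 2 + (ξ (yIdx i)) ^ 2)) / (ξ (tIdx n)) ^ 2)
          * (u ξ) ^ 2 := by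
  have hτ : ∀ ξ ∈ tsupport u, ξ (tIdx n) ≠ 0 := fun ξ hξ => (hsupp hξ).ne'
  have hu1 : ContDiff ℝ 1 u := hu.of_le (by exact_mod_cast le_top)
  let q : Heis n → ℝ := fun ξ => u ξ / ξ (tIdx n)
  have hq : ContDiff ℝ 1 q := contDiff_div_of_ne_zero_on_tsupport hu1 (contDiff_coord _) hτ
  have hqc : HasCompactSupport q := hc.mono fun ξ hξ h => hξ (by simp [q, h])
  have huq : u = fun ξ => ξ (tIdx n) * q ξ := by
    ext ξ
    by_cases h : ξ ∈ tsupport u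
    · exact (mul_div_cancel₀ (u ξ) (hτ ξ h)).symm
    · simp [q, image_eq_zero_of_notMem_tsupport h]
  have hW : (fun ξ : Heis n => ((∑ i : Fin n, ((ξ (xIdx i)) ^ 2 + (ξ (yIdx i)) ^ 2))
      / (ξ (tIdx n)) ^ 2) * (u ξ) ^ 2)
      = fun ξ => (∑ i : Fin n, (ξ (xIdx i) ^ 2 + ξ (yIdx i) ^ 2)) * q ξ ^ 2 := by
    ext ξ
    simp only [q]
    ring
  have hzero : ∀ ξ : Heis n, ξ ∉ {ξ : Heis n | 0 < ξ (tIdx n)} → ξ ∉ tsupport u :=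
    fun ξ hξ h => hξ (hsupp h)
  rw [setIntegral_eq_integral_of_forall_compl_eq_zero
      (fun ξ hξ => gradH2_eq_zero_of_notMem_tsupport (hzero ξ hξ)),
    setIntegral_eq_integral_of_forall_compl_eq_zero
      (fun ξ hξ => by simp [image_eq_zero_of_notMem_tsupport (hzero ξ hξ)]), hW]
  have hdiv := integral_hardyDiv (hu1.mul hq) (hc.mul_right (f' := q))
  have hWint : Integrable fun ξ : Heis n =>
      (∑ i : Fin n, (ξ (xIdx i) ^ 2 + ξ (yIdx i) ^ 2)) * q ξ ^ 2 := by
    have hqcont := hq.continuous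
    refine Continuous.integrable_of_hasCompactSupport (by fun_prop) ?_
    exact hqc.mono fun ξ hξ h => hξ (by simp [h])
  have hDint := integrable_finsetSum Finset.univ fun i _ => (hdiv i).1
  have hGint : Integrable (gradH2 u) :=
    (continuous_gradH2 hu1).integrable_of_hasCompactSupport
      (HasCompactSupport.intro hc fun ξ hξ => gradH2_eq_zero_of_notMem_tsupport hξ)
  have key := integral_mono (hWint.add hDint) hGint
    (hardyDiv_le (hq.differentiable one_ne_zero) huq)
  rw [integral_add' hWint hDint, integral_finsetSum _ fun i _ => (hdiv i).1,
    Finset.sum_eq_zero fun i _ => (hdiv i).2, add_zero] at key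
  exact key
end
end

section
/- Let n ≥ 1 and let ν = (ν_x, ν_y, ν_t) ∈ S^{2n} be a unit vector with ν_t = 0, d ∈ ℝ, and Π⁺_{ν,d} = {ξ ∈ ℝ^{2n+1} : ⟨ξ, ν⟩ > d}. Then for every u ∈ C_0^∞(Π⁺_{ν,d}) one has ∫_{Π⁺_{ν,d}} |∇_{ℍⁿ} u|² dξ ≥ (1/4) ∫_{Π⁺_{ν,d}} |u|² / dist(ξ, ∂Π⁺_{ν,d})² dξ, where dist(ξ, ∂Π⁺_{ν,d}) = ⟨ξ, ν⟩ − d. -/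
open MeasureTheory RealInnerProductSpace

noncomputable section

lemma sum_heis_coords {M : Type*} [AddCommMonoid M] {n : ℕ} (f : Fin (2 * n + 1) → M) :
    ∑ j, f j = ∑ i : Fin n, (f (xIdx i) + f (yIdx i)) + f (tIdx n) := by
  rw [Fin.sum_univ_castSucc, Finset.sum_add_distrib,
    ← Fin.sum_congr' (fun i => f i.castSucc) (two_mul n).symm, Fin.sum_univ_add]
  rfl

/-- The vertical part of the horizontal field `∑ i, (ν_{x_i} X_i + ν_{y_i} Y_i)`. -/
def vertCoeff {n : ℕ} (ν : Heis n) : Heis n →L[ℝ] ℝ :=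
  ∑ i : Fin n, ((2 * ν (xIdx i)) • EuclideanSpace.proj (yIdx i)
    - (2 * ν (yIdx i)) • EuclideanSpace.proj (xIdx i))

lemma vertCoeff_apply {n : ℕ} (ν ξ : Heis n) :
    vertCoeff ν ξ = ∑ i : Fin n, (2 * ν (xIdx i) * ξ (yIdx i) - 2 * ν (yIdx i) * ξ (xIdx i)) := by
  simp [vertCoeff]

lemma vertCoeff_single_tIdx {n : ℕ} (ν : Heis n) :
    vertCoeff ν (EuclideanSpace.single (tIdx n) 1) = 0 := by
  rw [vertCoeff_apply]
  refine Finset.sum_eq_zero fun i _ => ?_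
  have hx : xIdx i ≠ tIdx n := by simp only [xIdx, tIdx, ne_eq, Fin.mk.injEq]; omega
  have hy : yIdx i ≠ tIdx n := by simp only [yIdx, tIdx, ne_eq, Fin.mk.injEq]; omega
  simp [hx, hy]

/-- The derivative of `u` along `∑ i, (ν_{x_i} X_i + ν_{y_i} Y_i)`. -/
def horizDeriv {n : ℕ} (ν : Heis n) (u : Heis n → ℝ) (ξ : Heis n) : ℝ :=
  fderiv ℝ u ξ ν + vertCoeff ν ξ * fderiv ℝ u ξ (EuclideanSpace.single (tIdx n) 1)

lemma horizDeriv_eq_sum {n : ℕ} {ν : Heis n} (hνt : ν (tIdx n) = 0) (u : Heis n → ℝ)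
    (ξ : Heis n) :
    horizDeriv ν u ξ = ∑ i : Fin n, (ν (xIdx i) * Xd i u ξ + ν (yIdx i) * Yd i u ξ) := by
  have hν : ν = ∑ j, ν j • EuclideanSpace.single j (1 : ℝ) := by
    ext k
    simp [Pi.single_apply]
  have h : fderiv ℝ u ξ ν = ∑ j, ν j * fderiv ℝ u ξ (EuclideanSpace.single j 1) := by
    conv_lhs => rw [hν]
    simp
  rw [horizDeriv, h, sum_heis_coords, hνt, vertCoeff_apply, zero_mul, add_zero, Finset.sum_mul,
    ← Finset.sum_add_distrib]
  refine Finset.sum_congr rfl fun i _ => ?_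
  rw [Xd, Yd]
  ring

lemma horizDeriv_sq_le_gradH2 {n : ℕ} {ν : Heis n} (hν : ‖ν‖ = 1) (hνt : ν (tIdx n) = 0)
    (u : Heis n → ℝ) (ξ : Heis n) : horizDeriv ν u ξ ^ 2 ≤ gradH2 u ξ := by
  have hone : ∑ i : Fin n, (ν (xIdx i) ^ 2 + ν (yIdx i) ^ 2) = 1 := by
    have h := EuclideanSpace.real_norm_sq_eq ν
    rw [hν, sum_heis_coords, hνt] at h
    linarith
  have hcs := Finset.sum_mul_sq_le_sq_mul_sq (Finset.univ : Finset (Fin n ⊕ Fin n))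
    (Sum.elim (fun i => ν (xIdx i)) (fun i => ν (yIdx i)))
    (Sum.elim (fun i => Xd i u ξ) (fun i => Yd i u ξ))
  simp only [Fintype.sum_sum_type, Sum.elim_inl, Sum.elim_inr, ← Finset.sum_add_distrib] at hcs
  rwa [hone, one_mul, ← horizDeriv_eq_sum hνt] at hcs

lemma integrable_horizDeriv_and_integral_eq_zero {n : ℕ} (ν : Heis n) {g : Heis n → ℝ}
    (hg : ContDiff ℝ 1 g) (hc : HasCompactSupport g) :
    Integrable (horizDeriv ν g) ∧ ∫ ξ, horizDeriv ν g ξ = 0 := by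
  set e : Heis n := EuclideanSpace.single (tIdx n) 1 with he
  have hcont (v : Heis n) : Continuous fun ξ => fderiv ℝ g ξ v :=
    (hg.continuous_fderiv one_ne_zero).clm_apply continuous_const
  have hsupp (v : Heis n) : HasCompactSupport fun ξ => fderiv ℝ g ξ v := hc.fderiv_apply ℝ v
  have hint : Integrable fun ξ => fderiv ℝ g ξ ν := (hcont ν).integrable_of_hasCompactSupport
    (hsupp ν)
  have hint' : Integrable fun ξ => vertCoeff ν ξ * fderiv ℝ g ξ e :=
    ((vertCoeff ν).continuous.mul (hcont e)).integrable_of_hasCompactSupport (hsupp e).mul_left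
  have hdiff : Differentiable ℝ g := hg.differentiable one_ne_zero
  have hzero : ∫ ξ, fderiv ℝ g ξ ν = 0 := by
    have := integral_mul_fderiv_eq_neg_fderiv_mul_of_integrable (μ := volume)
      (f := fun _ : Heis n => (1 : ℝ)) (g := g) (v := ν) (by simp) (by simpa using hint)
      (by simpa using hg.continuous.integrable_of_hasCompactSupport hc)
      (fun _ _ => differentiableAt_const _) fun ξ _ => hdiff ξ
    simpa using this
  have hzero' : ∫ ξ, vertCoeff ν ξ * fderiv ℝ g ξ e = 0 := by
    have hc0 : vertCoeff ν e = 0 := vertCoeff_single_tIdx ν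
    have := integral_mul_fderiv_eq_neg_fderiv_mul_of_integrable (μ := volume)
      (f := vertCoeff ν) (g := g) (v := e) (by simp [hc0]) hint'
      (((vertCoeff ν).continuous.mul hg.continuous).integrable_of_hasCompactSupport hc.mul_left)
      (fun _ _ => (vertCoeff ν).differentiableAt) fun ξ _ => hdiff ξ
    simpa [hc0] using this
  refine ⟨hint.add hint', ?_⟩
  simp only [horizDeriv]
  rw [integral_add hint hint', hzero, hzero', add_zero]

lemma horizDeriv_mul {n : ℕ} (ν : Heis n) {f g : Heis n → ℝ} (hf : Differentiable ℝ f)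
    (hg : Differentiable ℝ g) (ξ : Heis n) :
    horizDeriv ν (fun η => f η * g η) ξ = f ξ * horizDeriv ν g ξ + g ξ * horizDeriv ν f ξ := by
  simp only [horizDeriv, fderiv_fun_mul (hf ξ) (hg ξ), add_apply,
    smul_apply, smul_eq_mul]
  ring

lemma horizDeriv_inner_sub {n : ℕ} {ν : Heis n} (hν : ‖ν‖ = 1) (hνt : ν (tIdx n) = 0) (d : ℝ)
    (ξ : Heis n) : horizDeriv ν (fun η => ⟪η, ν⟫ - d) ξ = 1 := by
  have h : (fun η : Heis n => ⟪η, ν⟫ - d) = fun η => innerSL ℝ ν η - d := by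
    ext η
    rw [innerSL_apply_apply, real_inner_comm]
  rw [horizDeriv, h, fderiv_sub_const, ContinuousLinearMap.fderiv]
  simp [hν, hνt, EuclideanSpace.inner_single_right]

/-- Corollary: for a vertical half-space (`ν_t = 0`) the Hardy inequality
holds with the plain weight `1/(4 dist(ξ, ∂Π⁺_{ν,d})²)`, where `dist(ξ, ∂Π⁺_{ν,d}) = ⟨ξ,ν⟩ − d`. -/
theorem hardy_vertical_halfspace (n : ℕ) (hn : 1 ≤ n) (ν : Heis n) (hν : ‖ν‖ = 1)
    (hνt : ν (tIdx n) = 0) (d : ℝ)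
    (u : Heis n → ℝ) (hu : ContDiff ℝ (⊤ : ℕ∞) u) (hc : HasCompactSupport u)
    (hsupp : tsupport u ⊆ {ξ : Heis n | d < ⟪ξ, ν⟫}) :
    ∫ ξ in {ξ : Heis n | d < ⟪ξ, ν⟫}, gradH2 u ξ ≥
      (1 / 4) * ∫ ξ in {ξ : Heis n | d < ⟪ξ, ν⟫},
        (u ξ) ^ 2 / (⟪ξ, ν⟫ - d) ^ 2 := by
  set s : Heis n → ℝ := fun ξ => ⟪ξ, ν⟫ - d with hs
  have hs_smooth : ContDiff ℝ 1 s :=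
    (contDiff_id.inner ℝ contDiff_const).sub contDiff_const
  have hu1 : ContDiff ℝ 1 u := hu.of_le (by exact_mod_cast le_top)
  have hs_ne {ξ : Heis n} (hξ : ξ ∈ tsupport u) : s ξ ≠ 0 := (sub_pos.2 (hsupp hξ)).ne'
  set w : Heis n → ℝ := fun ξ => u ξ / s ξ with hw
  have hwu : tsupport w ⊆ tsupport u := closure_mono fun ξ hξ hu0 => hξ (by simp [hw, hu0])
  have hw_smooth : ContDiff ℝ 1 w :=
    (contMDiff_of_tsupport fun ξ hξ =>
      (hu1.contDiffAt.div hs_smooth.contDiffAt (hs_ne (hwu hξ))).contMDiffAt).contDiff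
  have hw_supp : HasCompactSupport w := hc.mono' ((subset_tsupport w).trans hwu)
  have hu_eq : u = fun ξ => s ξ * w ξ := by
    ext ξ
    by_cases hξ : ξ ∈ tsupport u
    · simp only [hw]
      field_simp [hs_ne hξ]
    · simp [hw, image_eq_zero_of_notMem_tsupport hξ]
  have hg_smooth : ContDiff ℝ 1 fun ξ => w ξ * u ξ := hw_smooth.mul hu1
  obtain ⟨hg_int, hg_zero⟩ :=
    integrable_horizDeriv_and_integral_eq_zero ν hg_smooth hw_supp.mul_right
  have hpoint (ξ : Heis n) :
      1 / 4 * w ξ ^ 2 + 1 / 2 * horizDeriv ν (fun ξ => w ξ * u ξ) ξ ≤ gradH2 u ξ := by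
    have hwd := hw_smooth.differentiable one_ne_zero
    have hg := horizDeriv_mul ν hwd (hu1.differentiable one_ne_zero) ξ
    have huZ := horizDeriv_mul ν (hs_smooth.differentiable one_ne_zero) hwd ξ
    rw [← hu_eq, horizDeriv_inner_sub hν hνt] at huZ
    have hval : u ξ = s ξ * w ξ := congrFun hu_eq ξ
    have hgrad := horizDeriv_sq_le_gradH2 hν hνt u ξ
    have hmul : u ξ * horizDeriv ν w ξ = w ξ * (horizDeriv ν u ξ - w ξ) := by
      rw [huZ, hval]
      ring
    rw [hg, hmul]
    nlinarith [sq_nonneg (horizDeriv ν u ξ - w ξ / 2)]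
  have hw2_int : Integrable fun ξ => w ξ ^ 2 := by
    simp only [pow_two]
    exact (hw_smooth.continuous.mul hw_smooth.continuous).integrable_of_hasCompactSupport
      hw_supp.mul_right
  have hgrad_int : Integrable (gradH2 u) :=
    (continuous_gradH2 hu1).integrable_of_hasCompactSupport
      (HasCompactSupport.intro hc fun _ => gradH2_eq_zero_of_notMem_tsupport)
  have hL : ∫ ξ in {ξ : Heis n | d < ⟪ξ, ν⟫}, gradH2 u ξ = ∫ ξ, gradH2 u ξ :=
    setIntegral_eq_integral_of_forall_compl_eq_zero fun ξ hξ =>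
      gradH2_eq_zero_of_notMem_tsupport fun h => hξ (hsupp h)
  have hR : ∫ ξ in {ξ : Heis n | d < ⟪ξ, ν⟫}, u ξ ^ 2 / (⟪ξ, ν⟫ - d) ^ 2 = ∫ ξ, w ξ ^ 2 := by
    rw [setIntegral_eq_integral_of_forall_compl_eq_zero fun ξ hξ => by
      simp [image_eq_zero_of_notMem_tsupport fun h => hξ (hsupp h)]]
    simp only [hw, hs, div_pow]
  have hmono := integral_mono ((hw2_int.const_mul (1 / 4)).add (hg_int.const_mul (1 / 2)))
    hgrad_int hpoint
  rw [integral_add' (hw2_int.const_mul _) (hg_int.const_mul _), integral_const_mul,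
    integral_const_mul, hg_zero, mul_zero, add_zero] at hmono
  rw [hL, hR]
  exact hmono
end
end

section
/- Let n ≥ 1, p ≥ 2, ν ∈ S^{2n}, d ∈ ℝ, Π⁺_{ν,d} = {ξ ∈ ℝ^{2n+1} : ⟨ξ, ν⟩ > d}, and 1 ≤ i ≤ n. Then for every u ∈ C_0^∞(Π⁺_{ν,d}) one has ∫_{Π⁺_{ν,d}} |X_i u|^p dξ ≥ ((p−1)/p)^p ∫_{Π⁺_{ν,d}} |⟨X_i(ξ), ν⟩|^p / dist(ξ, ∂Π⁺_{ν,d})^p · |u|^p dξ, and likewise ∫_{Π⁺_{ν,d}} |Y_i u|^p dξ ≥ ((p−1)/p)^p ∫_{Π⁺_{ν,d}} |⟨Y_i(ξ), ν⟩|^p / dist(ξ, ∂Π⁺_{ν,d})^p · |u|^p dξ, where dist(ξ, ∂Π⁺_{ν,d}) = ⟨ξ, ν⟩ − d. -/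
open MeasureTheory RealInnerProductSpace

noncomputable section

lemma abs_rpow_sub_two_mul_self_mul_self {p : ℝ} (hp : 0 < p) (x : ℝ) :
    |x| ^ (p - 2) * x * x = |x| ^ p := by
  rcases eq_or_ne x 0 with rfl | hx
  · simp [Real.zero_rpow hp.ne']
  · rw [mul_assoc, ← abs_mul_abs_self, ← sq, ← Real.rpow_natCast, ← Real.rpow_add (abs_pos.2 hx)]
    norm_num

lemma abs_abs_rpow_sub_two_mul_self {p : ℝ} (hp : 1 < p) (x : ℝ) :
    |(|x| ^ (p - 2) * x)| = |x| ^ (p - 1) := by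
  rcases eq_or_ne x 0 with rfl | hx
  · simp [Real.zero_rpow (sub_pos.2 hp).ne']
  · rw [abs_mul, abs_of_nonneg (by positivity), ← Real.rpow_add_one (abs_pos.2 hx).ne']
    ring_nf

/-- Young's inequality with the weights adapted to the Hardy constant. -/
lemma hardy_young {p A B : ℝ} (hp : 1 < p) (hA : 0 ≤ A) (hB : 0 ≤ B) :
    ((p - 1) / p) ^ (p - 1) * (p * A ^ (p - 1) * B - (p - 1) * A ^ p)
      ≤ B ^ p - ((p - 1) / p) ^ p * A ^ p := by
  have hp0 : 0 < p := by linarith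
  have hp1 : 0 < p - 1 := by linarith
  set c := (p - 1) / p with hc
  have hc0 : 0 < c := by positivity
  have hy := Real.young_inequality_of_nonneg hB (by positivity : 0 ≤ (c * A) ^ (p - 1))
    (Real.HolderConjugate.conjExponent hp)
  rw [← Real.rpow_mul (by positivity), Real.conjExponent, mul_div_cancel₀ _ hp1.ne',
    Real.mul_rpow hc0.le hA, Real.mul_rpow hc0.le hA] at hy
  have hcp : c ^ p = c ^ (p - 1) * c := by rw [← Real.rpow_add_one hc0.ne']; ring_nf
  have hy' := mul_le_mul_of_nonneg_left hy hp0.le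
  have e : p * (B ^ p / p + c ^ p * A ^ p / (p / (p - 1)))
      = B ^ p + (p - 1) * (c ^ p * A ^ p) := by field_simp
  have e2 : c ^ (p - 1) * (p - 1) = p * c ^ p := by rw [hcp, hc]; field_simp
  rw [e] at hy'
  linear_combination hy' - A ^ p * e2

section HalfSpace

variable {E : Type*} [NormedAddCommGroup E] [InnerProductSpace ℝ E]

lemma contDiff_dist_rpow_mul_abs_rpow {p : ℝ} (hp : 1 < p) (q d : ℝ) (ν : E) {u : E → ℝ}
    (hu : ContDiff ℝ 1 u) (hsupp : tsupport u ⊆ {ξ : E | d < ⟪ξ, ν⟫}) :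
    ContDiff ℝ 1 (fun ξ => (⟪ξ, ν⟫ - d) ^ q * |u ξ| ^ p) := by
  rw [contDiff_iff_contDiffAt]
  intro ξ
  by_cases hξ : ξ ∈ tsupport u
  · have h : ⟪ξ, ν⟫ - d ≠ 0 := (sub_pos.2 (hsupp hξ)).ne'
    have h1 : ContDiffAt ℝ 1 (fun ξ : E => ⟪ξ, ν⟫ - d) ξ :=
      ((contDiff_id.inner ℝ contDiff_const).sub contDiff_const).contDiffAt
    exact (h1.rpow_const_of_ne h).mul (hu.norm_rpow hp).contDiffAt
  · have hev : (fun ξ => (⟪ξ, ν⟫ - d) ^ q * |u ξ| ^ p) =ᶠ[nhds ξ] fun _ => 0 := by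
      filter_upwards [notMem_tsupport_iff_eventuallyEq.1 hξ] with η hη
      simp [hη, Real.zero_rpow (by linarith : p ≠ 0)]
    exact contDiffAt_const.congr_of_eventuallyEq hev

lemma tsupport_dist_rpow_mul_abs_rpow_subset {p : ℝ} (hp : p ≠ 0) (q d : ℝ) (ν : E) (u : E → ℝ) :
    tsupport (fun ξ => (⟪ξ, ν⟫ - d) ^ q * |u ξ| ^ p) ⊆ tsupport u := by
  refine closure_mono fun ξ hξ hu => hξ ?_
  simp [hu, Real.zero_rpow hp]

lemma fderiv_dist_rpow_mul_abs_rpow {p : ℝ} (hp : 1 < p) {d : ℝ} {ν ξ : E} {u : E → ℝ}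
    (hu : DifferentiableAt ℝ u ξ) (hξ : d < ⟪ξ, ν⟫) (v : E) :
    fderiv ℝ (fun ξ => (⟪ξ, ν⟫ - d) ^ (1 - p) * |u ξ| ^ p) ξ v =
      (1 - p) * (⟪ξ, ν⟫ - d) ^ (-p) * ⟪v, ν⟫ * |u ξ| ^ p
        + (⟪ξ, ν⟫ - d) ^ (1 - p) * (p * |u ξ| ^ (p - 2) * u ξ * fderiv ℝ u ξ v) := by
  have h : ⟪ξ, ν⟫ - d ≠ 0 := (sub_pos.2 hξ).ne'
  have h1 : HasFDerivAt (fun ξ : E => ⟪ξ, ν⟫ - d) (innerSL ℝ ν) ξ := by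
    simpa [real_inner_comm] using (innerSL ℝ ν).hasFDerivAt.sub_const (x := ξ) d
  have h2 := (Real.hasDerivAt_rpow_const (p := 1 - p) (Or.inl h)).comp_hasFDerivAt ξ h1
  have h3 := (hasDerivAt_abs_rpow (u ξ) hp).comp_hasFDerivAt ξ hu.hasFDerivAt
  have h4 := (h2.mul h3).fderiv
  simp only [Function.comp_def, Pi.mul_def] at h4
  rw [h4]
  simp [real_inner_comm ν v, show (1 - p - 1 : ℝ) = -p by ring]
  ring

variable [FiniteDimensional ℝ E] [MeasurableSpace E] [BorelSpace E]

/-- A continuous function invariant along `v` integrates to zero against derivatives along `v`. -/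
lemma integral_mul_fderiv_eq_zero_s4 (μ : Measure E) [μ.IsAddHaarMeasure] {φ h : E → ℝ} {v : E}
    (hφ : Continuous φ) (hinv : ∀ (ξ : E) (s : ℝ), φ (ξ + s • v) = φ ξ)
    (hh : ContDiff ℝ 1 h) (hc : HasCompactSupport h) :
    ∫ ξ, φ ξ * fderiv ℝ h ξ v ∂μ = 0 := by
  have hd : Continuous fun ξ => fderiv ℝ h ξ v :=
    (hh.continuous_fderiv one_ne_zero).clm_apply continuous_const
  have hdc : HasCompactSupport fun ξ => fderiv ℝ h ξ v := hc.fderiv_apply ℝ v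
  have key := integral_bilinear_hasLineDerivAt_right_eq_neg_left_of_integrable (μ := μ)
    (f := φ) (f' := fun _ => 0) (g := h) (g' := fun ξ => fderiv ℝ h ξ v) (v := v)
    (B := ContinuousLinearMap.mul ℝ ℝ) (by simp)
    ((hφ.mul hd).integrable_of_hasCompactSupport hdc.mul_left)
    ((hφ.mul hh.continuous).integrable_of_hasCompactSupport hc.mul_left)
    (fun ξ _ => by simpa [HasLineDerivAt, hinv] using hasDerivAt_const (0 : ℝ) (φ ξ))
    (fun ξ _ => ((hh.differentiable one_ne_zero) ξ).hasFDerivAt.hasLineDerivAt v)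
  simpa using key

/-- The `L^p` Hardy inequality on a half-space for a vector field `e + ℓ τ` whose coefficient `ℓ`
is invariant along `e` and `τ`. -/
theorem hardy_halfspace_of_invariant_coeff (μ : Measure E) [μ.IsAddHaarMeasure] {p : ℝ}
    (hp : 2 ≤ p) (ν : E) (d : ℝ) {e τ : E} {ℓ : E → ℝ} (hℓ : Continuous ℓ)
    (he : ∀ (ξ : E) (s : ℝ), ℓ (ξ + s • e) = ℓ ξ) (hτ : ∀ (ξ : E) (s : ℝ), ℓ (ξ + s • τ) = ℓ ξ)
    {u : E → ℝ} (hu : ContDiff ℝ 1 u) (hc : HasCompactSupport u)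
    (hsupp : tsupport u ⊆ {ξ : E | d < ⟪ξ, ν⟫}) :
    ((p - 1) / p) ^ p * ∫ ξ in {ξ : E | d < ⟪ξ, ν⟫},
        |⟪e, ν⟫ + ℓ ξ * ⟪τ, ν⟫| ^ p / (⟪ξ, ν⟫ - d) ^ p * |u ξ| ^ p ∂μ
      ≤ ∫ ξ in {ξ : E | d < ⟪ξ, ν⟫}, |fderiv ℝ u ξ e + ℓ ξ * fderiv ℝ u ξ τ| ^ p ∂μ := by
  have hp1 : 1 < p := by linarith
  have hp0 : p ≠ 0 := by linarith
  set S := {ξ : E | d < ⟪ξ, ν⟫} with hS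
  have hSm : MeasurableSet S :=
    (isOpen_lt continuous_const (by fun_prop : Continuous fun ξ : E => ⟪ξ, ν⟫)).measurableSet
  set a : E → ℝ := fun ξ => ⟪e, ν⟫ + ℓ ξ * ⟪τ, ν⟫ with ha
  have hac : Continuous a := by fun_prop
  set V : E → ℝ := fun ξ => |a ξ| ^ (p - 2) * a ξ with hV
  have hVc : Continuous V :=
    (hac.abs.rpow_const fun _ => Or.inr (by linarith)).mul hac
  set h : E → ℝ := fun ξ => (⟪ξ, ν⟫ - d) ^ (1 - p) * |u ξ| ^ p with hh
  have hsub := tsupport_dist_rpow_mul_abs_rpow_subset hp0 (1 - p) d ν u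
  have hhC : ContDiff ℝ 1 h := contDiff_dist_rpow_mul_abs_rpow hp1 _ d ν hu hsupp
  have hhc : HasCompactSupport h := hc.of_isClosed_subset (isClosed_tsupport _) hsub
  have hdi (φ : E → ℝ) (hφ : Continuous φ) (v : E) :
      Integrable (fun ξ => φ ξ * fderiv ℝ h ξ v) μ :=
    (hφ.mul ((hhC.continuous_fderiv one_ne_zero).clm_apply
      continuous_const)).integrable_of_hasCompactSupport (hhc.fderiv_apply ℝ v).mul_left
  set D : E → ℝ := fun ξ => V ξ * fderiv ℝ h ξ e + V ξ * ℓ ξ * fderiv ℝ h ξ τ with hD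
  have hDi : Integrable D μ := (hdi _ hVc e).add (hdi _ (hVc.mul hℓ) τ)
  have hD0 : ∫ ξ in S, D ξ ∂μ = 0 := by
    rw [setIntegral_eq_integral_of_forall_compl_eq_zero]
    · rw [show ∫ ξ, D ξ ∂μ = ∫ ξ, V ξ * fderiv ℝ h ξ e ∂μ +
          ∫ ξ, (V * ℓ) ξ * fderiv ℝ h ξ τ ∂μ from
          integral_add (hdi _ hVc e) (hdi _ (hVc.mul hℓ) τ),
        integral_mul_fderiv_eq_zero_s4 μ hVc (fun ξ s => by simp [hV, ha, he]) hhC hhc,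
        integral_mul_fderiv_eq_zero_s4 μ (hVc.mul hℓ) (fun ξ s => by simp [hV, ha, hτ]) hhC hhc,
        add_zero]
    · intro ξ hξ
      have : fderiv ℝ h ξ = 0 := by
        by_contra hne
        exact hξ (hsupp (hsub (support_fderiv_subset ℝ hne)))
      simp [hD, this]
  have hAi : IntegrableOn (fun ξ => |a ξ| ^ p / (⟪ξ, ν⟫ - d) ^ p * |u ξ| ^ p) S μ := by
    have hi : Integrable (fun ξ => |a ξ| ^ p * ((⟪ξ, ν⟫ - d) ^ (-p) * |u ξ| ^ p)) μ :=
      ((hac.abs.rpow_const fun _ => Or.inr (by linarith)).mul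
        (contDiff_dist_rpow_mul_abs_rpow hp1 _ d ν hu
          hsupp).continuous).integrable_of_hasCompactSupport
        (HasCompactSupport.mul_left (hc.of_isClosed_subset (isClosed_tsupport _)
          (tsupport_dist_rpow_mul_abs_rpow_subset hp0 _ d ν u)))
    refine hi.integrableOn.congr_fun (fun ξ hξ => ?_) hSm
    simp only [Real.rpow_neg (sub_pos.2 hξ).le]
    ring
  have hZc (v : E) : Continuous fun ξ => fderiv ℝ u ξ v :=
    (hu.continuous_fderiv one_ne_zero).clm_apply continuous_const
  have hBi : IntegrableOn (fun ξ => |fderiv ℝ u ξ e + ℓ ξ * fderiv ℝ u ξ τ| ^ p) S μ := by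
    refine (Continuous.integrable_of_hasCompactSupport
      (((hZc e).add (hℓ.mul (hZc τ))).abs.rpow_const fun _ => Or.inr (by linarith))
      ((hc.fderiv ℝ).mono fun ξ hξ h0 => hξ ?_)).integrableOn
    simp [h0, Real.zero_rpow hp0]
  have key : ∫ ξ in S, ((p - 1) / p) ^ (p - 1) * D ξ ∂μ ≤
      ∫ ξ in S, (|fderiv ℝ u ξ e + ℓ ξ * fderiv ℝ u ξ τ| ^ p
        - ((p - 1) / p) ^ p * (|a ξ| ^ p / (⟪ξ, ν⟫ - d) ^ p * |u ξ| ^ p)) ∂μ := by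
    refine setIntegral_mono_on (hDi.integrableOn.const_mul _) (hBi.sub (hAi.const_mul _)) hSm
      fun ξ hξ => ?_
    have hδ : 0 < ⟪ξ, ν⟫ - d := sub_pos.2 hξ
    have hdu : DifferentiableAt ℝ u ξ := hu.differentiable one_ne_zero ξ
    set δ := ⟪ξ, ν⟫ - d with hδdef
    set Z := fderiv ℝ u ξ e + ℓ ξ * fderiv ℝ u ξ τ with hZ
    have hy := hardy_young hp1 (by positivity : 0 ≤ |a ξ| * |u ξ| / δ) (abs_nonneg Z)
    rw [Real.div_rpow (by positivity) hδ.le, Real.mul_rpow (abs_nonneg _) (abs_nonneg _),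
      Real.div_rpow (by positivity) hδ.le, Real.mul_rpow (abs_nonneg _) (abs_nonneg _)] at hy
    have hcp : 0 ≤ ((p - 1) / p) ^ (p - 1) :=
      Real.rpow_nonneg (div_nonneg (by linarith) (by linarith)) _
    have hDξ : D ξ = p * (δ ^ (1 - p) * (|a ξ| ^ (p - 2) * a ξ) * (|u ξ| ^ (p - 2) * u ξ) * Z)
        - (p - 1) * (|a ξ| ^ p * |u ξ| ^ p / δ ^ p) := by
      have h1 := abs_rpow_sub_two_mul_self_mul_self (by linarith : 0 < p) (a ξ)
      simp only [hD, hV, hh, fderiv_dist_rpow_mul_abs_rpow hp1 hdu hξ]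
      rw [← h1, ← hδdef, Real.rpow_neg hδ.le, hZ]
      simp only [ha]
      ring
    have hle : δ ^ (1 - p) * (|a ξ| ^ (p - 2) * a ξ) * (|u ξ| ^ (p - 2) * u ξ) * Z ≤
        |a ξ| ^ (p - 1) * |u ξ| ^ (p - 1) / δ ^ (p - 1) * |Z| := by
      refine (le_abs_self _).trans_eq ?_
      rw [abs_mul, abs_mul, abs_mul, abs_abs_rpow_sub_two_mul_self hp1,
        abs_abs_rpow_sub_two_mul_self hp1, abs_of_pos (Real.rpow_pos_of_pos hδ _),
        show 1 - p = -(p - 1) by ring, Real.rpow_neg hδ.le]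
      ring
    have hDle : D ξ ≤ p * (|a ξ| ^ (p - 1) * |u ξ| ^ (p - 1) / δ ^ (p - 1)) * |Z|
        - (p - 1) * (|a ξ| ^ p * |u ξ| ^ p / δ ^ p) := by
      rw [hDξ, mul_assoc p]
      gcongr
    rw [div_mul_eq_mul_div (|a ξ| ^ p)]
    exact (mul_le_mul_of_nonneg_left hDle hcp).trans hy
  rw [integral_const_mul, hD0, mul_zero, integral_sub hBi (hAi.const_mul _),
    integral_const_mul] at key
  linarith

end HalfSpace

/-- the componentwise `L^p` Hardy inequalities on the half-space `Π⁺_{ν,d}`: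
one for `X_i` and one for `Y_i`, each with constant `((p−1)/p)^p`. -/
theorem hardy_halfspace_Lp_components (n : ℕ) (hn : 1 ≤ n) (p : ℝ) (hp : 2 ≤ p)
    (ν : Heis n) (hν : ‖ν‖ = 1) (d : ℝ) (i : Fin n)
    (u : Heis n → ℝ) (hu : ContDiff ℝ (⊤ : ℕ∞) u) (hc : HasCompactSupport u)
    (hsupp : tsupport u ⊆ {ξ : Heis n | d < ⟪ξ, ν⟫}) :
    (∫ ξ in {ξ : Heis n | d < ⟪ξ, ν⟫}, |Xd i u ξ| ^ p ≥
      ((p - 1) / p) ^ p * ∫ ξ in {ξ : Heis n | d < ⟪ξ, ν⟫},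
        |XiNu i ξ ν| ^ p / (⟪ξ, ν⟫ - d) ^ p * |u ξ| ^ p) ∧
    (∫ ξ in {ξ : Heis n | d < ⟪ξ, ν⟫}, |Yd i u ξ| ^ p ≥
      ((p - 1) / p) ^ p * ∫ ξ in {ξ : Heis n | d < ⟪ξ, ν⟫},
        |YiNu i ξ ν| ^ p / (⟪ξ, ν⟫ - d) ^ p * |u ξ| ^ p) := by
  have hxy : xIdx i ≠ yIdx i := by simp [xIdx, yIdx]; omega
  have hxt : xIdx i ≠ tIdx n := by simp [xIdx, tIdx]; omega
  have hyt : yIdx i ≠ tIdx n := by simp [yIdx, tIdx]; omega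
  have hu1 : ContDiff ℝ 1 u := hu.of_le (by exact_mod_cast le_top)
  constructor
  · have h := hardy_halfspace_of_invariant_coeff volume hp ν d
      (e := EuclideanSpace.single (xIdx i) 1) (τ := EuclideanSpace.single (tIdx n) 1)
      (ℓ := fun ξ : Heis n => 2 * ξ (yIdx i)) (by fun_prop)
      (fun ξ s => by simp [hxy.symm]) (fun ξ s => by simp [hyt]) hu1 hc hsupp
    simpa [Xd, XiNu, EuclideanSpace.inner_single_left] using h
  · have h := hardy_halfspace_of_invariant_coeff volume hp ν d
      (e := EuclideanSpace.single (yIdx i) 1) (τ := EuclideanSpace.single (tIdx n) 1)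
      (ℓ := fun ξ : Heis n => -(2 * ξ (xIdx i))) (by fun_prop)
      (fun ξ s => by simp [hxy]) (fun ξ s => by simp [hxt]) hu1 hc hsupp
    simpa [Yd, YiNu, EuclideanSpace.inner_single_left, sub_eq_add_neg] using h
end
end

section
/- Let n ≥ 1 and let Ω ⊂ ℝ^{2n+1} be an open convex domain. For ξ ∈ Ω let ν(ξ) ∈ S^{2n} denote the outer unit normal of ∂Ω at a point ξ̂ ∈ ∂Ω realizing the Euclidean distance, i.e. dist(ξ, ∂Ω) = |ξ − ξ̂| and ξ̂ = ξ + dist(ξ, ∂Ω)ν(ξ). Then for every u ∈ C_0^∞(Ω) one has ∫_Ω |∇_{ℍⁿ} u|² dξ ≥ (1/4) ∫_Ω Σ_{i=1}^n (⟨X_i(ξ), ν(ξ)⟩² + ⟨Y_i(ξ), ν(ξ)⟩²) / dist(ξ, ∂Ω)² · |u|² dξ, where dist(ξ, ∂Ω) is the Euclidean distance from ξ to ∂Ω. The domain Ω is not assumed to be bounded. -/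
open MeasureTheory RealInnerProductSpace

noncomputable section

open Filter Topology

section Hardy

variable {E : Type*} [NormedAddCommGroup E]

/-- The time-`s` flow of the vector field `x ↦ v + ℓ x • w`, which runs along straight lines
when `ℓ v = ℓ w = 0`. -/
def shearFlow [NormedSpace ℝ E] {v w : E} {ℓ : E →L[ℝ] ℝ} (hv : ℓ v = 0) (hw : ℓ w = 0) (s : ℝ) :
    E ≃ₜ E where
  toFun x := x + s • (v + ℓ x • w)
  invFun x := x + (-s) • (v + ℓ x • w)
  left_inv x := by
    simp only [map_add, map_smul, hv, hw, smul_eq_mul, mul_zero, add_zero]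
    module
  right_inv x := by
    simp only [map_add, map_smul, hv, hw, smul_eq_mul, mul_zero, add_zero]
    module
  continuous_toFun := by fun_prop
  continuous_invFun := by fun_prop

lemma shearFlow_apply [NormedSpace ℝ E] {v w : E} {ℓ : E →L[ℝ] ℝ} (hv : ℓ v = 0) (hw : ℓ w = 0)
    (s : ℝ) (x : E) : shearFlow hv hw s x = x + s • (v + ℓ x • w) := rfl

lemma measurePreserving_shearFlow [NormedSpace ℝ E] [FiniteDimensional ℝ E] [MeasurableSpace E]
    [BorelSpace E] {v w : E} {ℓ : E →L[ℝ] ℝ} (hv : ℓ v = 0) (hw : ℓ w = 0) (s : ℝ)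
    (μ : Measure E) [μ.IsAddHaarMeasure] :
    MeasurePreserving (shearFlow hv hw s) μ μ := by
  set T : E →ₗ[ℝ] E := LinearMap.transvection (ℓ : E →ₗ[ℝ] ℝ) (s • w)
  have hdet : LinearMap.det T = 1 := by
    rw [LinearMap.transvection.det]
    simp [hw]
  have hT : MeasurePreserving T μ μ := by
    refine ⟨T.continuous_of_finiteDimensional.measurable, ?_⟩
    rw [Measure.map_linearMap_addHaar_eq_smul_addHaar μ (by simp [hdet])]
    simp [hdet]
  convert (measurePreserving_add_right μ (s • v)).comp hT using 1
  ext x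
  simp only [shearFlow_apply, Function.comp_apply, T, LinearMap.transvection.apply,
    ContinuousLinearMap.coe_coe]
  module

lemma tendsto_integral_sq_slope [NormedSpace ℝ E] [MeasurableSpace E]
    [BorelSpace E] (μ : Measure E) [IsFiniteMeasureOnCompacts μ] {v w : E} {ℓ : E →L[ℝ] ℝ}
    (hv : ℓ v = 0) (hw : ℓ w = 0) {u : E → ℝ} (hu : ContDiff ℝ 1 u) (hc : HasCompactSupport u) :
    Tendsto (fun s : ℝ ↦ ∫ x, (s⁻¹ * (u (shearFlow hv hw s x) - u x)) ^ 2 ∂μ) (𝓝[>] 0)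
      (𝓝 (∫ x, (fderiv ℝ u x (v + ℓ x • w)) ^ 2 ∂μ)) := by
  obtain ⟨C, hC⟩ := hu.lipschitzWith_of_hasCompactSupport hc one_ne_zero
  set V : E → E := fun x ↦ v + ℓ x • w with hV
  have hVc : Continuous V := by fun_prop
  set K : Set E := (fun p : ℝ × E ↦ p.2 + (-p.1) • V p.2) '' (Set.Icc 0 1 ×ˢ tsupport u)
  have hK : IsCompact K := (isCompact_Icc.prod hc).image (by fun_prop)
  refine tendsto_integral_filter_of_dominated_convergence
    (K.indicator fun x ↦ (C * ‖V x‖) ^ 2) ?_ ?_ ?_ ?_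
  · refine Eventually.of_forall fun s ↦ ?_
    have := (shearFlow hv hw s).continuous
    have := hu.continuous
    exact Continuous.aestronglyMeasurable (by fun_prop)
  · filter_upwards [Ioo_mem_nhdsGT (zero_lt_one' ℝ)] with s hs
    refine Eventually.of_forall fun x ↦ ?_
    rw [Real.norm_of_nonneg (sq_nonneg _)]
    by_cases hx : x ∈ K
    · rw [Set.indicator_of_mem hx, ← sq_abs]
      gcongr
      rw [abs_mul, abs_of_pos (inv_pos.2 hs.1), inv_mul_le_iff₀ hs.1]
      have h := hC.dist_le_mul (shearFlow hv hw s x) x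
      have h2 : dist (shearFlow hv hw s x) x = s * ‖V x‖ := by
        rw [dist_eq_norm, shearFlow_apply, add_sub_cancel_left, norm_smul,
          Real.norm_of_nonneg hs.1.le]
      rw [h2, Real.dist_eq] at h
      linarith
    · have h1 : u x = 0 := by
        by_contra h
        exact hx ⟨(0, x), ⟨by simp, subset_tsupport u h⟩, by simp⟩
      have h2 : u (shearFlow hv hw s x) = 0 := by
        by_contra h
        exact hx ⟨(s, shearFlow hv hw s x), ⟨⟨hs.1.le, hs.2.le⟩, subset_tsupport u h⟩,
          (shearFlow hv hw s).left_inv x⟩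
      simp [h1, h2, Set.indicator_of_notMem hx]
  · rw [integrable_indicator_iff hK.measurableSet]
    exact ContinuousOn.integrableOn_compact hK (by fun_prop)
  · refine Eventually.of_forall fun x ↦ ?_
    have hd : HasDerivAt (fun s : ℝ ↦ u (x + s • V x)) (fderiv ℝ u x (V x)) 0 := by
      have h1 : HasDerivAt (fun s : ℝ ↦ x + s • V x) (V x) 0 := by
        simpa using ((hasDerivAt_id (0 : ℝ)).smul_const (V x)).const_add x
      have h2 : HasFDerivAt u (fderiv ℝ u x) (x + (0 : ℝ) • V x) := by
        simpa using (hu.differentiable one_ne_zero x).hasFDerivAt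
      exact h2.comp_hasDerivAt 0 h1
    simpa [shearFlow_apply, hV] using (hd.tendsto_slope_zero_right).pow 2

lemma sq_div_sub_mul_sub_le {a b A B : ℝ} (hA : 0 ≤ A) (hB : 0 ≤ B) (ha : A = 0 → a = 0)
    (hb : B = 0 → b = 0) : (a ^ 2 / A - b ^ 2 / B) * (A - B) ≤ (a - b) ^ 2 := by
  rcases hA.eq_or_lt with rfl | hA
  · rcases hB.eq_or_lt with rfl | hB
    · simp [sq_nonneg]
    · simp [ha rfl]
      field_simp
      exact le_rfl
  · rcases hB.eq_or_lt with rfl | hB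
    · simp [hb rfl]
      field_simp
      exact le_rfl
    · have : (a - b) ^ 2 - (a ^ 2 / A - b ^ 2 / B) * (A - B) = (a * B - b * A) ^ 2 / (A * B) := by
        field_simp
        ring
      have : 0 ≤ (a * B - b * A) ^ 2 / (A * B) := by positivity
      linarith

/-- A discrete form of the ground state representation: testing the second difference of `f`
against `u ^ 2 / f` is controlled by the squared first difference of `u`. -/
lemma integral_sq_div_mul_secondDiff_le {X : Type*} [TopologicalSpace X] [MeasurableSpace X]
    [BorelSpace X] [SecondCountableTopology X] {μ : Measure X} [IsFiniteMeasureOnCompacts μ]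
    (φ : X ≃ₜ X) (hφ : MeasurePreserving φ μ μ) {u f : X → ℝ} (hu : Continuous u)
    (hc : HasCompactSupport u) (hf : Continuous f) (hf0 : ∀ x, 0 ≤ f x)
    (hg : Continuous fun x ↦ u x ^ 2 / f x) (hfu : ∀ x, f x = 0 → u x = 0) :
    Integrable (fun x ↦ u x ^ 2 / f x * (2 * f x - f (φ x) - f (φ.symm x))) μ ∧
    ∫ x, u x ^ 2 / f x * (2 * f x - f (φ x) - f (φ.symm x)) ∂μ ≤
      ∫ x, (u (φ x) - u x) ^ 2 ∂μ := by
  set g : X → ℝ := fun x ↦ u x ^ 2 / f x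
  have hgc : HasCompactSupport g := hc.mono fun x hx ↦ by
    contrapose! hx
    simp only [Function.mem_support, not_not] at hx ⊢
    simp [g, hx]
  have hφc := φ.continuous
  have hψc := φ.symm.continuous
  have int {h k : X → ℝ} (hh : Continuous h) (hk : Continuous k) (hs : HasCompactSupport h) :
      Integrable (fun x ↦ h x * k x) μ :=
    (hh.mul hk).integrable_of_hasCompactSupport hs.mul_right
  have i1 := int hg hf hgc
  have i2 := int hg (hf.comp hφc) hgc
  have i3 := int hg (hf.comp hψc) hgc
  have hgφ : HasCompactSupport (g ∘ φ) := hgc.comp_homeomorph φ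
  have i4 := int (hg.comp hφc) (hf.comp hφc) hgφ
  have i5 := int (hg.comp hφc) hf hgφ
  simp only [Function.comp_apply] at i2 i3 i4 i5
  have e4 : ∫ x, g (φ x) * f (φ x) ∂μ = ∫ x, g x * f x ∂μ :=
    hφ.integral_comp φ.measurableEmbedding fun x ↦ g x * f x
  have e5 : ∫ x, g (φ x) * f x ∂μ = ∫ x, g x * f (φ.symm x) ∂μ := by
    simpa using hφ.integral_comp φ.measurableEmbedding fun x ↦ g x * f (φ.symm x)
  have hsplit : (fun x ↦ u x ^ 2 / f x * (2 * f x - f (φ x) - f (φ.symm x))) =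
      fun x ↦ g x * f x + g x * f x - g x * f (φ x) - g x * f (φ.symm x) := by
    funext x
    simp only [g]
    ring
  rw [hsplit]
  have i11 : Integrable (fun x ↦ g x * f x + g x * f x) μ := i1.add i1
  have i112 : Integrable (fun x ↦ g x * f x + g x * f x - g x * f (φ x)) μ := i11.sub i2
  have i45 : Integrable (fun x ↦ g (φ x) * f (φ x) - g (φ x) * f x) μ := i4.sub i5
  have i452 : Integrable (fun x ↦ g (φ x) * f (φ x) - g (φ x) * f x - g x * f (φ x)) μ :=
    i45.sub i2
  refine ⟨i112.sub i3, ?_⟩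
  have key : ∫ x, (g x * f x + g x * f x - g x * f (φ x) - g x * f (φ.symm x)) ∂μ =
      ∫ x, (g (φ x) * f (φ x) - g (φ x) * f x - g x * f (φ x) + g x * f x) ∂μ := by
    rw [integral_sub i112 i3, integral_sub i11 i2, integral_add i1 i1, integral_add i452 i1,
      integral_sub i45 i2, integral_sub i4 i5, e4, e5]
    ring
  rw [key]
  refine integral_mono (i452.add i1) ?_ fun x ↦ ?_
  · refine Continuous.integrable_of_hasCompactSupport (by fun_prop) ?_
    have hd : HasCompactSupport fun x ↦ u (φ x) - u x := (hc.comp_homeomorph φ).sub hc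
    exact hd.comp_left (g := fun t : ℝ ↦ t ^ 2) (by simp)
  · have := sq_div_sub_mul_sub_le (hf0 (φ x)) (hf0 x) (hfu _) (hfu _)
    simp only [g]
    linarith

lemma sqrt_add_sqrt_le {d q : ℝ} (hd : 0 < d) (hq : |q| ≤ d) :
    √(d + q) + √(d - q) ≤ 2 * √d - q ^ 2 / (4 * d * √d) := by
  obtain ⟨h1, h2⟩ := abs_le.1 hq
  set r := √d
  have hr : 0 < r := Real.sqrt_pos.2 hd
  have hrd : r ^ 2 = d := Real.sq_sqrt hd.le
  have hq2 : q ^ 2 ≤ d ^ 2 := sq_le_sq' h1 h2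
  have hprod : √(d + q) * √(d - q) ≤ d - q ^ 2 / (2 * d) := by
    rw [← Real.sqrt_mul (by linarith)]
    refine Real.sqrt_le_iff.2 ⟨?_, ?_⟩
    · rw [sub_nonneg, div_le_iff₀ (by positivity)]
      nlinarith
    · have : (d - q ^ 2 / (2 * d)) ^ 2 = (d + q) * (d - q) + (q ^ 2 / (2 * d)) ^ 2 := by
        field_simp
        ring
      have := sq_nonneg (q ^ 2 / (2 * d))
      linarith
  have hs1 := Real.sq_sqrt (show 0 ≤ d + q by linarith)
  have hs2 := Real.sq_sqrt (show 0 ≤ d - q by linarith)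
  refine abs_le_of_sq_le_sq' ?_ ?_ |>.2
  · have : (2 * r - q ^ 2 / (4 * d * r)) ^ 2 = 4 * d - q ^ 2 / d + (q ^ 2 / (4 * d * r)) ^ 2 := by
      rw [← hrd]
      field_simp
      ring
    have h3 := sq_nonneg (q ^ 2 / (4 * d * r))
    have h4 : q ^ 2 / (2 * d) * 2 = q ^ 2 / d := by
      field_simp
    nlinarith
  · rw [sub_nonneg, div_le_iff₀ (by positivity)]
    have : 2 * r * (4 * d * r) = 8 * d ^ 2 := by
      rw [← hrd]
      ring
    nlinarith

lemma inner_add_infDist_compl_mul_norm_le [InnerProductSpace ℝ E] {Ω : Set E} {x w : E} {M : ℝ}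
    (hx : x ∈ Ω) (h : ∀ p ∈ Ω, ⟪w, p⟫ < M) : ⟪w, x⟫ + Metric.infDist x Ωᶜ * ‖w‖ ≤ M := by
  by_contra! hM
  have hxM := h x hx
  have hw : 0 < ‖w‖ := by
    refine (norm_nonneg w).lt_of_ne fun h0 ↦ ?_
    rw [← h0] at hM
    linarith
  have ht : 0 < (M - ⟪w, x⟫) / ‖w‖ ^ 2 := div_pos (by linarith) (by positivity)
  have hmem : x + ((M - ⟪w, x⟫) / ‖w‖ ^ 2) • w ∈ Ω := by
    apply Metric.ball_infDist_compl_subset (x := x)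
    rw [Metric.mem_ball, dist_eq_norm, add_sub_cancel_left, norm_smul, Real.norm_of_nonneg ht.le]
    have : (M - ⟪w, x⟫) / ‖w‖ ^ 2 * ‖w‖ = (M - ⟪w, x⟫) / ‖w‖ := by field_simp
    rw [this, div_lt_iff₀ hw]
    linarith
  have := h _ hmem
  rw [inner_add_right, inner_smul_right, real_inner_self_eq_norm_sq,
    div_mul_cancel₀ _ (by positivity)] at this
  linarith

/-- If the distance from `x` to the complement of a convex open set is attained in the unit
direction `ν`, then `-ν` is a superdifferential at `x` of that distance. -/
lemma infDist_compl_le_of_convex [InnerProductSpace ℝ E] [CompleteSpace E] {Ω : Set E}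
    (hopen : IsOpen Ω) (hconv : Convex ℝ Ω) {x ν : E} (hx : x ∈ Ω) (hν : ‖ν‖ = 1)
    (hnear : x + Metric.infDist x Ωᶜ • ν ∉ Ω) {y : E} (hy : y ∈ Ω) :
    Metric.infDist y Ωᶜ ≤ Metric.infDist x Ωᶜ - ⟪ν, y - x⟫ := by
  set d := Metric.infDist x Ωᶜ
  have hd : 0 < d := (hopen.isClosed_compl.notMem_iff_infDist_pos ⟨_, hnear⟩).1 (by simpa using hx)
  obtain ⟨ℓ, hℓ⟩ := geometric_hahn_banach_open_point hconv hopen hnear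
  set w := (InnerProductSpace.toDual ℝ E).symm ℓ
  have hw (p : E) : ℓ p = ⟪w, p⟫ := InnerProductSpace.toDual_symm_apply.symm
  simp only [hw] at hℓ
  have h1 := inner_add_infDist_compl_mul_norm_le hx hℓ
  rw [inner_add_right, inner_smul_right, add_le_add_iff_left, mul_le_mul_iff_right₀ hd] at h1
  have h2 := real_inner_le_norm w ν
  have h3 : ‖ν‖ • w = ‖w‖ • ν :=
    inner_eq_norm_mul_iff_real.1 (le_antisymm h2 (by rwa [hν, mul_one]))
  rw [hν, one_smul] at h3
  have hν' : ∀ p ∈ Ω, ⟪ν, p⟫ < ⟪ν, x + d • ν⟫ := fun p hp ↦ by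
    have := hℓ p hp
    rw [h3, real_inner_smul_left, real_inner_smul_left] at this
    exact lt_of_mul_lt_mul_left this (norm_nonneg w)
  have h4 := inner_add_infDist_compl_mul_norm_le hy hν'
  rw [inner_add_right, inner_smul_right, real_inner_self_eq_norm_sq, hν] at h4
  rw [inner_sub_right]
  linarith

lemma infDist_frontier_eq_infDist_compl [InnerProductSpace ℝ E] [FiniteDimensional ℝ E]
    {Ω : Set E} (hopen : IsOpen Ω) (hne : (frontier Ω).Nonempty) {x : E} (hx : x ∈ Ω) :
    Metric.infDist x (frontier Ω) = Metric.infDist x Ωᶜ := by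
  have hsub : frontier Ω ⊆ Ωᶜ := fun y hy h ↦ hopen.inter_frontier_eq.le ⟨h, hy⟩
  refine le_antisymm ?_ (Metric.infDist_le_infDist_of_subset hsub hne)
  obtain ⟨y, hy, hxy⟩ := exists_mem_frontier_infDist_compl_eq_dist hx
    (Set.nonempty_compl.1 (hne.mono hsub))
  exact hxy ▸ Metric.infDist_le_dist_of_mem hy

lemma continuous_sq_div {X : Type*} [TopologicalSpace X] {u f : X → ℝ} (hu : Continuous u)
    (hf : Continuous f) (hfu : ∀ x ∈ tsupport u, f x ≠ 0) :
    Continuous fun x ↦ u x ^ 2 / f x := by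
  refine continuous_iff_continuousAt.2 fun x ↦ ?_
  by_cases hx : x ∈ tsupport u
  · exact (hu.pow 2).continuousAt.div hf.continuousAt (hfu x hx)
  · refine continuousAt_const.congr (f := fun _ ↦ (0 : ℝ)) ?_
    filter_upwards [(isClosed_tsupport u).isOpen_compl.mem_nhds hx] with y hy
    simp [image_eq_zero_of_notMem_tsupport hy]

variable [InnerProductSpace ℝ E] [FiniteDimensional ℝ E] [MeasurableSpace E] [BorelSpace E]
  (μ : Measure E) [μ.IsAddHaarMeasure]

/-- For small times `s`, the Hardy weight along a shear field is dominated by an integrable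
function whose integral is at most that of the squared difference quotient of `u`. -/
lemma eventually_exists_hardy_majorant {Ω : Set E} (hopen : IsOpen Ω) (hconv : Convex ℝ Ω)
    (hne : Ωᶜ.Nonempty) {ν : E → E} (hν1 : ∀ x ∈ Ω, ‖ν x‖ = 1)
    (hνnear : ∀ x ∈ Ω, x + Metric.infDist x Ωᶜ • ν x ∉ Ω) {u : E → ℝ} (hu : Continuous u)
    (hc : HasCompactSupport u) (hsupp : tsupport u ⊆ Ω) {v w : E} {ℓ : E →L[ℝ] ℝ}
    (hv : ℓ v = 0) (hw : ℓ w = 0) :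
    ∀ᶠ s : ℝ in 𝓝[>] 0, ∃ F : E → ℝ, Integrable F μ ∧
      (∀ x, 1 / 4 * (⟪v + ℓ x • w, ν x⟫ ^ 2 / Metric.infDist x Ωᶜ ^ 2 * u x ^ 2) ≤ F x) ∧
      (∀ x ∉ Ω, F x = 0) ∧
      ∫ x, F x ∂μ ≤ ∫ x, (s⁻¹ * (u (shearFlow hv hw s x) - u x)) ^ 2 ∂μ := by
  set d : E → ℝ := fun x ↦ Metric.infDist x Ωᶜ
  have hdc : Continuous d := Metric.continuous_infDist_pt _
  have hdpos {x : E} (hx : x ∈ Ω) : 0 < d x :=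
    (hopen.isClosed_compl.notMem_iff_infDist_pos hne).1 (by simpa using hx)
  set V : E → E := fun x ↦ v + ℓ x • w
  have hVc : Continuous V := by fun_prop
  obtain ⟨δ, hδ, hδK⟩ : ∃ δ > 0, ∀ x ∈ tsupport u, δ ≤ d x / (‖V x‖ + 1) := by
    refine IsCompact.exists_forall_le' hc (f := fun x ↦ d x / (‖V x‖ + 1)) ?_ fun x hx ↦ ?_
    · exact (hdc.div (by fun_prop) fun x ↦ by positivity).continuousOn
    · exact div_pos (hdpos (hsupp hx)) (by positivity)
  have hu0 {x : E} (hx : x ∉ Ω) : u x = 0 := image_eq_zero_of_notMem_tsupport fun h ↦ hx (hsupp h)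
  filter_upwards [Ioo_mem_nhdsGT hδ] with s hs
  have hs0 := hs.1
  set φ := shearFlow hv hw s
  set f : E → ℝ := fun x ↦ √(d x)
  have hfc : Continuous f := by fun_prop
  obtain ⟨hFi, hFle⟩ := integral_sq_div_mul_secondDiff_le φ
    (measurePreserving_shearFlow hv hw s μ) hu hc hfc (fun x ↦ Real.sqrt_nonneg _)
    (continuous_sq_div hu hfc fun x hx ↦ (Real.sqrt_pos.2 (hdpos (hsupp hx))).ne')
    fun x hx ↦ hu0 fun h ↦ (Real.sqrt_pos.2 (hdpos h)).ne' hx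
  refine ⟨fun x ↦ s⁻¹ ^ 2 * (u x ^ 2 / f x * (2 * f x - f (φ x) - f (φ.symm x))),
    hFi.const_mul _, fun x ↦ ?_, fun x hx ↦ by simp [hu0 hx], ?_⟩
  · by_cases hxs : x ∈ tsupport u
    swap
    · simp [image_eq_zero_of_notMem_tsupport hxs]
    have hx := hsupp hxs
    have hd := hdpos hx
    set p := ⟪V x, ν x⟫
    have hq : |s * p| ≤ d x := by
      have h1 : |p| ≤ ‖V x‖ := by
        simpa [hν1 x hx] using abs_real_inner_le_norm (V x) (ν x)
      have h2 : s * (‖V x‖ + 1) ≤ d x :=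
        (le_div_iff₀ (by positivity)).1 (hs.2.le.trans (hδK x hxs))
      rw [abs_mul, abs_of_pos hs0]
      nlinarith
    have hstep (t : ℝ) : f (x + t • V x) ≤ √(d x - t * p) := by
      by_cases hy : x + t • V x ∈ Ω
      · refine Real.sqrt_le_sqrt ?_
        have := infDist_compl_le_of_convex hopen hconv hx (hν1 x hx) (hνnear x hx) hy
        rwa [add_sub_cancel_left, inner_smul_right, real_inner_comm] at this
      · have : d (x + t • V x) = 0 := Metric.infDist_zero_of_mem hy
        simp [f, this]
    have h1 : f (φ x) ≤ √(d x - s * p) := hstep s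
    have h2 : f (φ.symm x) ≤ √(d x + s * p) := by
      have := hstep (-s)
      rwa [neg_mul, sub_neg_eq_add] at this
    have h3 := sqrt_add_sqrt_le hd hq
    have hf : 0 < f x := Real.sqrt_pos.2 hd
    have hff : f x ^ 2 = d x := Real.sq_sqrt hd.le
    have h4 : (s * p) ^ 2 / (4 * d x * f x) ≤ 2 * f x - f (φ x) - f (φ.symm x) := by
      simp only [f] at *
      linarith
    calc 1 / 4 * (p ^ 2 / d x ^ 2 * u x ^ 2)
        = s⁻¹ ^ 2 * (u x ^ 2 / f x * ((s * p) ^ 2 / (4 * d x * f x))) := by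
          rw [← hff]
          field_simp
      _ ≤ s⁻¹ ^ 2 * (u x ^ 2 / f x * (2 * f x - f (φ x) - f (φ.symm x))) := by gcongr
  · simp only [mul_pow]
    rw [integral_const_mul, integral_const_mul]
    gcongr

/-- The geometric Hardy inequality on a convex open set, for a finite family of shear fields
`x ↦ v j + ℓ j x • w j`. -/
lemma hardy_convex_shear {J : Type*} [Fintype J] {Ω : Set E} (hopen : IsOpen Ω)
    (hconv : Convex ℝ Ω) (hne : Ωᶜ.Nonempty) {ν : E → E} (hν1 : ∀ x ∈ Ω, ‖ν x‖ = 1)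
    (hνnear : ∀ x ∈ Ω, x + Metric.infDist x Ωᶜ • ν x ∉ Ω) {u : E → ℝ} (hu : ContDiff ℝ 1 u)
    (hc : HasCompactSupport u) (hsupp : tsupport u ⊆ Ω) {v w : J → E} {ℓ : J → E →L[ℝ] ℝ}
    (hv : ∀ j, ℓ j (v j) = 0) (hw : ∀ j, ℓ j (w j) = 0) :
    1 / 4 * ∫ x in Ω, (∑ j, ⟪v j + ℓ j x • w j, ν x⟫ ^ 2) / Metric.infDist x Ωᶜ ^ 2 * u x ^ 2 ∂μ ≤
      ∫ x in Ω, ∑ j, (fderiv ℝ u x (v j + ℓ j x • w j)) ^ 2 ∂μ := by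
  have hlim := tendsto_finsetSum Finset.univ fun j _ ↦
    tendsto_integral_sq_slope μ (hv j) (hw j) hu hc
  have hgrad : ∫ x in Ω, ∑ j, (fderiv ℝ u x (v j + ℓ j x • w j)) ^ 2 ∂μ =
      ∑ j, ∫ x, (fderiv ℝ u x (v j + ℓ j x • w j)) ^ 2 ∂μ := by
    have hcf := hu.continuous_fderiv one_ne_zero
    have h0 {x : E} (hx : x ∉ tsupport u) : fderiv ℝ u x = 0 :=
      image_eq_zero_of_notMem_tsupport fun h ↦ hx (tsupport_fderiv_subset ℝ h)
    rw [setIntegral_eq_integral_of_forall_compl_eq_zero fun x hx ↦ by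
      simp [h0 fun h ↦ hx (hsupp h)]]
    refine integral_finsetSum _ fun j _ ↦ ?_
    refine Continuous.integrable_of_hasCompactSupport (by fun_prop) ?_
    refine HasCompactSupport.intro hc fun x hx ↦ ?_
    simp [h0 hx]
  rw [hgrad]
  refine ge_of_tendsto hlim ?_
  have hev := eventually_all.2 fun j ↦ eventually_exists_hardy_majorant μ hopen hconv hne hν1
    hνnear hu.continuous hc hsupp (hv j) (hw j)
  filter_upwards [hev] with s hs
  choose F hFi hFge hF0 hFle using hs
  calc _ ≤ ∫ x in Ω, ∑ j, F j x ∂μ := by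
        rw [← integral_const_mul]
        refine integral_mono_of_nonneg (Eventually.of_forall fun x ↦ ?_)
          (integrable_finsetSum _ fun j _ ↦ (hFi j).integrableOn) (Eventually.of_forall fun x ↦ ?_)
        · dsimp only [Pi.zero_apply]
          positivity
        · dsimp only
          rw [Finset.sum_div, Finset.sum_mul, Finset.mul_sum]
          exact Finset.sum_le_sum fun j _ ↦ hFge j x
    _ = ∑ j, ∫ x, F j x ∂μ := by
        rw [setIntegral_eq_integral_of_forall_compl_eq_zero fun x hx ↦
          Finset.sum_eq_zero fun j _ ↦ hF0 j x hx]
        exact integral_finsetSum _ fun j _ ↦ hFi j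
    _ ≤ _ := Finset.sum_le_sum fun j _ ↦ hFle j

end Hardy

/-- Theorem 3 of the paper: the geometric `L²` Hardy inequality on a
(possibly unbounded) open convex domain `Ω ⊆ ℍⁿ`. For `ξ ∈ Ω`, `ν ξ` is a unit vector such
that `ξ̂ = ξ + dist(ξ, ∂Ω) • ν ξ ∈ ∂Ω` realizes the Euclidean distance from `ξ` to `∂Ω`
(so `ν ξ` is the outer unit normal of `∂Ω` at `ξ̂`). -/
theorem hardy_convex_L2 (n : ℕ) (hn : 1 ≤ n) (Ω : Set (Heis n))
    (hopen : IsOpen Ω) (hconv : Convex ℝ Ω)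
    (ν : Heis n → Heis n) (hν1 : ∀ ξ ∈ Ω, ‖ν ξ‖ = 1)
    (hνnear : ∀ ξ ∈ Ω, ξ + Metric.infDist ξ (frontier Ω) • ν ξ ∈ frontier Ω)
    (u : Heis n → ℝ) (hu : ContDiff ℝ (⊤ : ℕ∞) u) (hc : HasCompactSupport u)
    (hsupp : tsupport u ⊆ Ω) :
    ∫ ξ in Ω, gradH2 u ξ ≥
      (1 / 4) * ∫ ξ in Ω,
        (∑ i : Fin n, ((XiNu i ξ (ν ξ)) ^ 2 + (YiNu i ξ (ν ξ)) ^ 2))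
          / (Metric.infDist ξ (frontier Ω)) ^ 2 * (u ξ) ^ 2 := by
  rcases Ω.eq_empty_or_nonempty with rfl | ⟨x₀, hx₀⟩
  · simp
  have hne : (frontier Ω).Nonempty := ⟨_, hνnear x₀ hx₀⟩
  have hsub : frontier Ω ⊆ Ωᶜ := fun y hy h ↦ hopen.inter_frontier_eq.le ⟨h, hy⟩
  have hd : ∀ x ∈ Ω, Metric.infDist x (frontier Ω) = Metric.infDist x Ωᶜ := fun x hx ↦
    infDist_frontier_eq_infDist_compl hopen hne hx
  have hnear : ∀ x ∈ Ω, x + Metric.infDist x Ωᶜ • ν x ∉ Ω := fun x hx ↦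
    hsub (hd x hx ▸ hνnear x hx)
  let v : Fin n ⊕ Fin n → Heis n :=
    Sum.elim (fun i ↦ EuclideanSpace.single (xIdx i) 1) fun i ↦ EuclideanSpace.single (yIdx i) 1
  let ℓ : Fin n ⊕ Fin n → Heis n →L[ℝ] ℝ :=
    Sum.elim (fun i ↦ (2 : ℝ) • EuclideanSpace.proj (yIdx i))
      fun i ↦ (-2 : ℝ) • EuclideanSpace.proj (xIdx i)
  have hxy (i : Fin n) : yIdx i ≠ xIdx i := by simp [xIdx, yIdx]; omega
  have hxt (i : Fin n) : xIdx i ≠ tIdx n := by simp [xIdx, tIdx]; omega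
  have hyt (i : Fin n) : yIdx i ≠ tIdx n := by simp [yIdx, tIdx]; omega
  have hv (j : Fin n ⊕ Fin n) : ℓ j (v j) = 0 := by
    rcases j with i | i <;> simp [ℓ, v, hxy i, (hxy i).symm]
  have hw (j : Fin n ⊕ Fin n) : ℓ j (EuclideanSpace.single (tIdx n) 1) = 0 := by
    rcases j with i | i <;> simp [ℓ, hxt i, hyt i]
  have key := hardy_convex_shear volume hopen hconv (hne.mono hsub) hν1 hnear
    (hu.of_le (by exact_mod_cast le_top)) hc hsupp hv hw
  have hgrad (x : Heis n) : ∑ j, (fderiv ℝ u x (v j + ℓ j x • EuclideanSpace.single (tIdx n) 1)) ^ 2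
      = gradH2 u x := by
    simp [Fintype.sum_sum_type, gradH2, Xd, Yd, v, ℓ, Finset.sum_add_distrib, sub_eq_add_neg]
  have hweight (x : Heis n) : ∑ j, ⟪v j + ℓ j x • EuclideanSpace.single (tIdx n) 1, ν x⟫ ^ 2
      = ∑ i : Fin n, ((XiNu i x (ν x)) ^ 2 + (YiNu i x (ν x)) ^ 2) := by
    simp [Fintype.sum_sum_type, XiNu, YiNu, v, ℓ, Finset.sum_add_distrib, sub_eq_add_neg,
      inner_add_left, inner_smul_left, EuclideanSpace.inner_single_left]
  simp only [hgrad, hweight] at key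
  refine le_trans (le_of_eq ?_) key
  congr 1
  exact setIntegral_congr_fun hopen.measurableSet fun x hx ↦ by simp only [hd x hx]
end
end
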